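/- Fix an increasing sequence (k_n)_{n≥1} of positive integers with k_n ≤ n for all n and k_n → ∞, and set rat_n = B_{n−1,k_n}/B_{n,k_n}. Let ⟨x⟩ be the equivalence class of the projection function (x_i)_{i≥1} ↦ x_1. Then, asymptotically as n → ∞, P_n⟨x⟩ ∼ (5/8)·rat_n; moreover P_n⟨x⟩ is asymptotically equal to the ratio of equivalence classes of simple-x trees (of type T or type X) of size n among all equivalence classes of trees of size n. -/

import Mathlib

open Filter

namespace CatalanSat

/-- A logical connective: `and` or `or`. -/
inductive Conn : Type
  | and : Conn
  | or : Conn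

/-- An and/or tree: a binary plane tree with internal nodes labelled by a
connective and leaves labelled by a literal `(v, b)`: variable `v`, positive
if `b = true`, negated if `b = false`. -/
inductive AOTree : Type
  | leaf (v : ℕ) (b : Bool) : AOTree
  | node (c : Conn) (l r : AOTree) : AOTree

namespace AOTree

/-- The list of leaf labels (variable index, polarity), from left to right. -/
def leaves : AOTree → List (ℕ × Bool)
  | .leaf v b => [(v, b)]
  | .node _ l r => leaves l ++ leaves r

/-- The size of an and/or tree is its number of leaves. -/
def size (t : AOTree) : ℕ := t.leaves.length

/-- The number of distinct variables appearing as leaf labels. -/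
def varCount (t : AOTree) : ℕ := (t.leaves.map Prod.fst).toFinset.card

/-- The Boolean function computed by an and/or tree. -/
def eval : AOTree → (ℕ → Bool) → Bool
  | .leaf v b, x => if b then x v else !(x v)
  | .node .and l r, x => eval l x && eval r x
  | .node .or l r, x => eval l x || eval r x

end AOTree

/-- A tree-structure: a binary plane tree with internal nodes labelled by a
connective and unlabelled leaves. -/
inductive Shape : Type
  | leaf : Shape
  | node (c : Conn) (l r : Shape) : Shape

/-- The size of a tree-structure is its number of leaves. -/
def Shape.size : Shape → ℕ
  | .leaf => 1
  | .node _ l r => Shape.size l + Shape.size r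

/-- The tree-structure of an and/or tree (forget the leaf labels). -/
def AOTree.shape : AOTree → Shape
  | .leaf _ _ => .leaf
  | .node c l r => .node c l.shape r.shape

/-- The label of the `i`-th leaf (junk default when out of range). -/
def lv (t : AOTree) (i : ℕ) : ℕ × Bool := t.leaves.getD i (0, true)

/-- Two and/or trees are equivalent when they have the same tree-structure,
two leaves are labelled by the same variable in one iff they are in the other,
and two leaves are labelled by the same literal in one iff they are in the other. -/
def TreeEquiv (A B : AOTree) : Prop :=
  A.shape = B.shape ∧
  ∀ i j : ℕ, i < A.leaves.length → j < A.leaves.length →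
    (((lv A i).1 = (lv A j).1) ↔ ((lv B i).1 = (lv B j).1)) ∧
    ((lv A i = lv A j) ↔ (lv B i = lv B j))

/-- The equivalence relation on Boolean functions induced by equivalence of trees. -/
def FunEquiv (f g : (ℕ → Bool) → Bool) : Prop :=
  ∃ A B : AOTree, TreeEquiv A B ∧ A.eval = f ∧ B.eval = g

/-- The number of equivalence classes of and/or trees satisfying a property
(the property being assumed invariant under equivalence). -/
noncomputable def classCount (P : AOTree → Prop) : ℕ :=
  Nat.card (Quot (fun A B : {t : AOTree // P t} => TreeEquiv A.1 B.1))

/-- `Tcount n K`: number of equivalence classes of and/or trees of size `n`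
using at most `K` distinct variables. -/
noncomputable def Tcount (n K : ℕ) : ℕ := classCount fun t => t.size = n ∧ t.varCount ≤ K

/-- Number of such classes computing a function of the class `⟨f⟩`. -/
noncomputable def TcountClass (n K : ℕ) (f : (ℕ → Bool) → Bool) : ℕ :=
  classCount fun t => t.size = n ∧ t.varCount ≤ K ∧ FunEquiv t.eval f

/-- `P_n⟨f⟩`: the probability that a uniform equivalence class of trees of size
`n` (at most `K` variables) computes a function of `⟨f⟩`. -/
noncomputable def Pclass (n K : ℕ) (f : (ℕ → Bool) → Bool) : ℝ :=
  (TcountClass n K f : ℝ) / (Tcount n K : ℝ)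

/-- Number of classes of size `n`, at most `K` variables, computing exactly `f`. -/
noncomputable def TcountEval (n K : ℕ) (f : (ℕ → Bool) → Bool) : ℕ :=
  classCount fun t => t.size = n ∧ t.varCount ≤ K ∧ t.eval = f

/-- Stirling numbers of the second kind. -/
def stirling : ℕ → ℕ → ℕ
  | 0, 0 => 1
  | 0, _ + 1 => 0
  | _ + 1, 0 => 0
  | n + 1, k + 1 => (k + 1) * stirling n (k + 1) + stirling n k

/-- `B n k = Σ_{p=1}^{k} S(n,p)·2^{−p}`. -/
noncomputable def B (n k : ℕ) : ℝ :=
  ∑ p ∈ Finset.Icc 1 k, (stirling n p : ℝ) / 2 ^ p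

/-- `a n p = p^n/(p!·2^p)`. -/
noncomputable def a (n p : ℕ) : ℝ :=
  (p : ℝ) ^ n / ((Nat.factorial p : ℝ) * 2 ^ p)

/-- `rat_n = B_{n−1,k_n}/B_{n,k_n}`. -/
noncomputable def rat (k : ℕ → ℕ) (n : ℕ) : ℝ := B (n - 1) (k n) / B n (k n)

/-- The complexity `L(f)`: minimal size of an and/or tree computing `f`. -/
noncomputable def complexity (f : (ℕ → Bool) → Bool) : ℕ :=
  sInf {m | ∃ t : AOTree, t.size = m ∧ t.eval = f}

/-- The variable `x_i` is essential for `f`. -/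
def Essential (i : ℕ) (f : (ℕ → Bool) → Bool) : Prop :=
  ∃ x : ℕ → Bool, f (Function.update x i false) ≠ f (Function.update x i true)

/-- `E(f)`: the number of essential variables of `f`. -/
noncomputable def essCount (f : (ℕ → Bool) → Bool) : ℕ :=
  Nat.card {i : ℕ // Essential i f}

/-- The multiplicity `R⟨f⟩ = L⟨f⟩ − E⟨f⟩`. -/
noncomputable def mult (f : (ℕ → Bool) → Bool) : ℕ := complexity f - essCount f

/-- `M` is, for each `n ≥ 1`, an index of `{1,…,n}` maximizing `p ↦ p^n/(p!·2^p)`. -/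
def IsArgmax (M : ℕ → ℕ) : Prop :=
  ∀ n, 1 ≤ n → M n ∈ Finset.Icc 1 n ∧ ∀ p ∈ Finset.Icc 1 n, a n p ≤ a n (M n)

/-- There is a leaf labelled by the given literal linked to the root by
`∨`-labelled internal nodes only. -/
def orLeaf : AOTree → ℕ × Bool → Prop
  | .leaf v b, l => (v, b) = l
  | .node .or A B, l => orLeaf A l ∨ orLeaf B l
  | .node .and _ _, _ => False

/-- There is a leaf labelled by the given literal linked to the root by
`∧`-labelled internal nodes only. -/
def andLeaf : AOTree → ℕ × Bool → Prop
  | .leaf v b, l => (v, b) = l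
  | .node .and A B, l => andLeaf A l ∨ andLeaf B l
  | .node .or _ _, _ => False

/-- A simple tautology: two leaves labelled by a variable and its negation,
both linked to the root through `∨`-connectives only. -/
def IsSimpleTautology (t : AOTree) : Prop :=
  ∃ v b, orLeaf t (v, b) ∧ orLeaf t (v, !b)

/-- A simple contradiction: the dual notion. -/
def IsSimpleContradiction (t : AOTree) : Prop :=
  ∃ v b, andLeaf t (v, b) ∧ andLeaf t (v, !b)

/-- A tautology: a tree computing the constant function `true`. -/
def IsTautology (t : AOTree) : Prop := ∀ x : ℕ → Bool, t.eval x = true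

/-- A simple-x of type T: one subtree of the root is a single leaf, the other
is a simple tautology if the root is `∧`, a simple contradiction if it is `∨`. -/
def IsSimpleXT (t : AOTree) : Prop :=
  (∃ v b s, (t = .node .and (.leaf v b) s ∨ t = .node .and s (.leaf v b)) ∧
    IsSimpleTautology s) ∨
  (∃ v b s, (t = .node .or (.leaf v b) s ∨ t = .node .or s (.leaf v b)) ∧
    IsSimpleContradiction s)

/-- A simple-x of type X: one subtree of the root is a single leaf `ℓ`, the root
is `∧` (resp. `∨`), and the other subtree has a leaf labelled by the literal of
`ℓ` linked to its root by `∨`-only (resp. `∧`-only) internal nodes. -/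
def IsSimpleXX (t : AOTree) : Prop :=
  (∃ v b s, (t = .node .and (.leaf v b) s ∨ t = .node .and s (.leaf v b)) ∧
    orLeaf s (v, b)) ∨
  (∃ v b s, (t = .node .or (.leaf v b) s ∨ t = .node .or s (.leaf v b)) ∧
    andLeaf s (v, b))

open Finset.HasAntidiagonal (antidiagonal mem_antidiagonal)

instance : DecidableEq Conn := fun a b => by
  cases a <;> cases b <;> first | exact isTrue rfl | exact isFalse (by simp)

/-- The other connective. -/
def Conn.dual : Conn → Conn
  | .and => .or
  | .or => .and

/-- The neutral truth value of a connective: the opposite value at one child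
decides the node. -/
def Conn.val : Conn → Bool
  | .and => true
  | .or => false

/-- The truth table of a connective. -/
def Conn.op : Conn → Bool → Bool → Bool
  | .and => Bool.and
  | .or => Bool.or

/-- The leaf positions of a tree-structure. -/
inductive Pos : Shape → Type
  | here : Pos .leaf
  | inl {c : Conn} {l r : Shape} (i : Pos l) : Pos (.node c l r)
  | inr {c : Conn} {l r : Shape} (i : Pos r) : Pos (.node c l r)

namespace Pos

variable {c : Conn} {l r : Shape}

/-- A function on the leaf positions of a node, given on both subtrees. -/
def elim {α : Type} (f : Pos l → α) (g : Pos r → α) : Pos (.node c l r) → α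
  | .inl i => f i
  | .inr i => g i

/-- The leaf positions of a node are those of its two subtrees. -/
def sumEquiv : Pos l ⊕ Pos r ≃ Pos (.node c l r) where
  toFun := Sum.elim inl inr
  invFun := elim Sum.inl Sum.inr
  left_inv := by rintro (i | i) <;> rfl
  right_inv := by rintro (i | i) <;> rfl

instance instFintype : (s : Shape) → Fintype (Pos s)
  | .leaf => ⟨{.here}, fun | .here => Finset.mem_singleton_self _⟩
  | .node _ l r =>
    letI := instFintype l
    letI := instFintype r
    Fintype.ofEquiv _ sumEquiv

noncomputable instance (s : Shape) : DecidableEq (Pos s) := Classical.decEq _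

theorem card_eq (s : Shape) : Fintype.card (Pos s) = s.size := by
  induction s with
  | leaf => rfl
  | node c l r ihl ihr =>
    rw [← Fintype.card_congr (sumEquiv (c := c) (l := l) (r := r)), Fintype.card_sum, ihl, ihr]
    rfl

/-- The union of a set of leaf positions of the left subtree and one of the right subtree. -/
def join (A : Finset (Pos l)) (B : Finset (Pos r)) : Finset (Pos (.node c l r)) :=
  (A.disjSum B).map sumEquiv.toEmbedding

@[simp] theorem inl_mem_join {A : Finset (Pos l)} {B : Finset (Pos r)} {i : Pos l} :
    (inl i : Pos (.node c l r)) ∈ join A B ↔ i ∈ A := by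
  simp [join, sumEquiv, elim]

@[simp] theorem inr_mem_join {A : Finset (Pos l)} {B : Finset (Pos r)} {i : Pos r} :
    (inr i : Pos (.node c l r)) ∈ join A B ↔ i ∈ B := by
  simp [join, sumEquiv, elim]

theorem card_join (A : Finset (Pos l)) (B : Finset (Pos r)) :
    (join A B : Finset (Pos (.node c l r))).card = A.card + B.card := by
  rw [join, Finset.card_map, Finset.card_disjSum]

end Pos

/-- Evaluation of a tree-structure from the truth values at its leaves. -/
def Shape.ev : (s : Shape) → (Pos s → Bool) → Bool
  | .leaf, g => g .here
  | .node c l r, g => c.op (l.ev fun i => g (.inl i)) (r.ev fun i => g (.inr i))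

/-- The leaf positions listed from left to right. -/
def posList : (s : Shape) → List (Pos s)
  | .leaf => [.here]
  | .node _ l r => (posList l).map Pos.inl ++ (posList r).map Pos.inr

theorem mem_posList {s : Shape} (i : Pos s) : i ∈ posList s := by
  induction i with
  | here => exact List.mem_singleton.2 rfl
  | inl i ih => exact List.mem_append_left _ (List.mem_map_of_mem ih)
  | inr i ih => exact List.mem_append_right _ (List.mem_map_of_mem ih)

/-- The truth value of a literal. -/
def litVal (l : ℕ × Bool) (x : ℕ → Bool) : Bool := x l.1 == l.2

/-- The literal itself (for `b = false`) or its negation (for `b = true`). -/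
def sgn (b : Bool) (l : ℕ × Bool) : ℕ × Bool := (l.1, l.2 ^^ b)

/-- The tree with a given structure and given leaf labels. -/
def ofShape : (s : Shape) → (Pos s → ℕ × Bool) → AOTree
  | .leaf, f => .leaf (f .here).1 (f .here).2
  | .node c l r, f => .node c (ofShape l fun i => f (.inl i)) (ofShape r fun i => f (.inr i))

/-- A tree decomposed into its structure and its leaf labels. -/
def toShape : AOTree → (s : Shape) × (Pos s → ℕ × Bool)
  | .leaf v b => ⟨.leaf, fun _ => (v, b)⟩
  | .node c l r => ⟨.node c (toShape l).1 (toShape r).1, Pos.elim (toShape l).2 (toShape r).2⟩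

theorem toShape_ofShape (s : Shape) (f : Pos s → ℕ × Bool) : toShape (ofShape s f) = ⟨s, f⟩ := by
  induction s with
  | leaf =>
    refine congrArg (Sigma.mk _) (funext fun i => ?_)
    cases i
    rfl
  | node c l r ihl ihr =>
    simp only [ofShape, toShape]
    rw [ihl, ihr]
    refine congrArg (Sigma.mk _) (funext fun i => ?_)
    cases i <;> rfl

theorem ofShape_toShape (t : AOTree) : ofShape (toShape t).1 (toShape t).2 = t := by
  induction t with
  | leaf v b => rfl
  | node c l r ihl ihr =>
    simp only [toShape, ofShape, Pos.elim]
    rw [ihl, ihr]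

theorem shape_ofShape (s : Shape) (f : Pos s → ℕ × Bool) : (ofShape s f).shape = s := by
  induction s with
  | leaf => rfl
  | node c l r ihl ihr => simp only [ofShape, AOTree.shape, ihl, ihr]

theorem leaves_ofShape (s : Shape) (f : Pos s → ℕ × Bool) :
    (ofShape s f).leaves = (posList s).map f := by
  induction s with
  | leaf => rfl
  | node c l r ihl ihr =>
    simp only [ofShape, AOTree.leaves, ihl, ihr, posList, List.map_append, List.map_map]
    rfl

theorem size_ofShape (s : Shape) (f : Pos s → ℕ × Bool) : (ofShape s f).size = s.size := by
  induction s with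
  | leaf => rfl
  | node c l r ihl ihr =>
    simp only [AOTree.size] at ihl ihr
    simp only [AOTree.size, ofShape, AOTree.leaves, List.length_append, ihl, ihr, Shape.size]

theorem eval_ofShape (s : Shape) (f : Pos s → ℕ × Bool) (x : ℕ → Bool) :
    (ofShape s f).eval x = s.ev fun i => litVal (f i) x := by
  induction s with
  | leaf =>
    simp only [ofShape, AOTree.eval, Shape.ev, litVal]
    cases (f .here).2 <;> simp
  | node c l r ihl ihr => cases c <;> simp only [ofShape, AOTree.eval, Shape.ev, ihl, ihr] <;> rfl

/-- The number of distinct variables of a labelling. -/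
def vars {ι : Type} [Fintype ι] (f : ι → ℕ × Bool) : ℕ :=
  (Finset.univ.image fun i => (f i).1).card

theorem varCount_ofShape (s : Shape) (f : Pos s → ℕ × Bool) :
    (ofShape s f).varCount = vars f := by
  rw [AOTree.varCount, vars, leaves_ofShape]
  congr 1
  ext v
  simp only [List.map_map, List.mem_toFinset, List.mem_map, Finset.mem_image, Finset.mem_univ,
    true_and, mem_posList, Function.comp]

/-- The pair of equivalence relations (same variable, same literal) of a labelling. -/
def ker {ι : Type} (f : ι → ℕ × Bool) (i j : ι) : Prop × Prop :=
  ((f i).1 = (f j).1, f i = f j)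

theorem ker_eq_iff {ι : Type} {f g : ι → ℕ × Bool} :
    ker f = ker g ↔ ∀ i j, ((f i).1 = (f j).1 ↔ (g i).1 = (g j).1) ∧ (f i = f j ↔ g i = g j) := by
  simp only [funext_iff, ker, Prod.ext_iff (x := (_, _)), eq_iff_iff]

theorem treeEquiv_ofShape {s : Shape} (f g : Pos s → ℕ × Bool) :
    TreeEquiv (ofShape s f) (ofShape s g) ↔ ker f = ker g := by
  have hlv : ∀ (f : Pos s → ℕ × Bool) (i : ℕ) (hi : i < (posList s).length),
      lv (ofShape s f) i = f (posList s)[i] := by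
    intro f i hi
    simp [lv, leaves_ofShape, hi]
  rw [TreeEquiv, ker_eq_iff, shape_ofShape, shape_ofShape, leaves_ofShape, List.length_map]
  constructor
  · rintro ⟨-, h⟩ p q
    obtain ⟨i, hi, rfl⟩ := List.getElem_of_mem (mem_posList p)
    obtain ⟨j, hj, rfl⟩ := List.getElem_of_mem (mem_posList q)
    have := h i j hi hj
    rwa [hlv f i hi, hlv f j hj, hlv g i hi, hlv g j hj] at this
  · refine fun h => ⟨rfl, fun i j hi hj => ?_⟩
    rw [hlv f i hi, hlv f j hj, hlv g i hi, hlv g j hj]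
    exact h _ _

/-- The invariant of a tree that classifies it up to equivalence. -/
def treeKey (t : AOTree) : (s : Shape) × (Pos s → Pos s → Prop × Prop) :=
  ⟨(toShape t).1, ker (toShape t).2⟩

theorem treeKey_ofShape (s : Shape) (f : Pos s → ℕ × Bool) :
    treeKey (ofShape s f) = ⟨s, ker f⟩ := by
  rw [treeKey, toShape_ofShape]

theorem treeEquiv_iff (A B : AOTree) : TreeEquiv A B ↔ treeKey A = treeKey B := by
  obtain ⟨s, f, rfl⟩ : ∃ s f, ofShape s f = A := ⟨_, _, ofShape_toShape A⟩
  obtain ⟨s', g, rfl⟩ : ∃ s f, ofShape s f = B := ⟨_, _, ofShape_toShape B⟩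
  rw [treeKey_ofShape, treeKey_ofShape]
  constructor
  · intro h
    have hs : s = s' := by rw [← shape_ofShape s f, h.1, shape_ofShape]
    subst hs
    rw [(treeEquiv_ofShape f g).1 h]
  · intro h
    obtain ⟨rfl, h⟩ := Sigma.mk.inj h
    exact (treeEquiv_ofShape f g).2 (eq_of_heq h)

theorem Shape.size_pos (s : Shape) : 0 < s.size := by
  induction s with
  | leaf => exact Nat.one_pos
  | node c l r ihl ihr => exact Nat.add_pos_left ihl _

theorem finite_shapes (n : ℕ) : {s : Shape | s.size = n}.Finite := by
  induction n using Nat.strong_induction_on with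
  | _ n ih =>
    have h : ({s : Shape | s.size = n}) ⊆ {Shape.leaf} ∪
        ⋃ p ∈ {p : ℕ × ℕ | p.1 < n ∧ p.2 < n}, ⋃ c ∈ ({.and, .or} : Set Conn),
          Set.image2 (Shape.node c) {s | s.size = p.1} {s | s.size = p.2} := by
      intro s hs
      cases s with
      | leaf => exact Or.inl rfl
      | node c l r =>
        have hs' : l.size + r.size = n := hs
        have := l.size_pos
        have := r.size_pos
        refine Or.inr (Set.mem_biUnion (x := (l.size, r.size))
          ⟨by change l.size < n; omega, by change r.size < n; omega⟩
          (Set.mem_biUnion (x := c) (by cases c <;> simp) ⟨l, rfl, r, rfl, rfl⟩))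
    refine Set.Finite.subset ((Set.finite_singleton _).union (Set.Finite.biUnion ?_ ?_)) h
    · exact ((Set.finite_Iio n).prod (Set.finite_Iio n)).subset fun p hp => hp
    · exact fun p hp => Set.Finite.biUnion (Set.toFinite _) fun c _ =>
        Set.Finite.image2 _ (ih _ hp.1) (ih _ hp.2)

/-- The finite set of tree-structures with `n` leaves. -/
noncomputable def shapes (n : ℕ) : Finset Shape := (finite_shapes n).toFinset

@[simp] theorem mem_shapes {n : ℕ} {s : Shape} : s ∈ shapes n ↔ s.size = n := by
  simp [shapes]

theorem classCount_eq (n : ℕ) (Q : AOTree → Prop) :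
    classCount (fun t => t.size = n ∧ Q t) =
      ∑ s ∈ shapes n, (ker '' {f : Pos s → ℕ × Bool | Q (ofShape s f)}).ncard := by
  let key : {t : AOTree // t.size = n ∧ Q t} → treeKey '' {t | t.size = n ∧ Q t} :=
    fun t => ⟨treeKey t.1, t.1, t.2, rfl⟩
  have hcard : classCount (fun t => t.size = n ∧ Q t) =
      (treeKey '' {t | t.size = n ∧ Q t}).ncard := by
    refine Nat.card_congr (Equiv.ofBijective
      (Quot.lift key fun A B h => Subtype.ext ((treeEquiv_iff _ _).1 h)) ⟨?_, ?_⟩)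
    · rintro ⟨A⟩ ⟨B⟩ h
      exact Quot.sound ((treeEquiv_iff _ _).2 (congrArg Subtype.val h))
    · rintro ⟨_, t, ht, rfl⟩
      exact ⟨Quot.mk _ ⟨t, ht⟩, rfl⟩
  have himg : treeKey '' {t | t.size = n ∧ Q t} = ((shapes n).sigma fun s =>
      (Set.toFinite (ker '' {f : Pos s → ℕ × Bool | Q (ofShape s f)})).toFinset :
      Finset ((s : Shape) × (Pos s → Pos s → Prop × Prop))) := by
    ext ⟨s, q⟩
    simp only [Set.mem_image, Set.mem_ofPred_eq, Finset.coe_sigma, Set.mem_sigma_iff,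
      Finset.mem_coe, mem_shapes, Set.Finite.mem_toFinset]
    constructor
    · rintro ⟨t, ⟨ht, hQ⟩, h⟩
      obtain ⟨s', f, rfl⟩ : ∃ s f, ofShape s f = t := ⟨_, _, ofShape_toShape t⟩
      rw [treeKey_ofShape] at h
      obtain ⟨rfl, h⟩ := Sigma.mk.inj h
      exact ⟨by rw [← ht, size_ofShape], f, hQ, eq_of_heq h⟩
    · rintro ⟨hs, f, hQ, rfl⟩
      exact ⟨ofShape s f, ⟨by rw [size_ofShape, hs], hQ⟩, treeKey_ofShape s f⟩
  rw [hcard, himg, Set.ncard_coe_finset, Finset.card_sigma]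
  exact Finset.sum_congr rfl fun s _ => (Set.ncard_eq_toFinset_card _).symm

theorem sum_shapes {M : Type*} [AddCommMonoid M] (n : ℕ) (g : Shape → M) :
    ∑ s ∈ shapes (n + 2), g s = ∑ p ∈ antidiagonal (n + 2), ∑ l ∈ shapes p.1,
      ∑ r ∈ shapes p.2, (g (.node .and l r) + g (.node .or l r)) := by
  have h : ∀ p : ℕ × ℕ, ∑ l ∈ shapes p.1, ∑ r ∈ shapes p.2,
      (g (.node .and l r) + g (.node .or l r)) =
      ∑ q ∈ (shapes p.1 ×ˢ shapes p.2) ×ˢ ({.and, .or} : Finset Conn),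
        g (.node q.2 q.1.1 q.1.2) := by
    intro p
    rw [Finset.sum_product, Finset.sum_product]
    refine Finset.sum_congr rfl fun l _ => Finset.sum_congr rfl fun r _ => ?_
    rw [Finset.sum_pair (by simp)]
  simp_rw [h]
  rw [Finset.sum_sigma']
  symm
  refine Finset.sum_bij (fun q _ => Shape.node q.2.2 q.2.1.1 q.2.1.2) ?_ ?_ ?_ ?_
  · rintro ⟨p, ⟨l, r⟩, c⟩ hq
    simp only [Finset.mem_sigma, mem_antidiagonal, Finset.mem_product, mem_shapes] at hq
    simp only [mem_shapes, Shape.size]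
    omega
  · rintro ⟨p, ⟨l, r⟩, c⟩ hq ⟨p', ⟨l', r'⟩, c'⟩ hq' h
    simp only [Finset.mem_sigma, Finset.mem_product, mem_shapes] at hq hq'
    simp only [Shape.node.injEq] at h
    obtain ⟨rfl, rfl, rfl⟩ := h
    obtain rfl : p = p' := Prod.ext (by omega) (by omega)
    rfl
  · intro s hs
    cases s with
    | leaf => simp [Shape.size] at hs
    | node c l r =>
      refine ⟨⟨(l.size, r.size), (l, r), c⟩, ?_, rfl⟩
      have : l.size + r.size = n + 2 := mem_shapes.1 hs
      simp only [Finset.mem_sigma, mem_antidiagonal, Finset.mem_product, mem_shapes]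
      cases c <;> simp [this]
  · intros; rfl

theorem shapes_zero : shapes 0 = ∅ := by
  ext s
  simpa using s.size_pos.ne'

theorem shapes_one : shapes 1 = {Shape.leaf} := by
  ext s
  cases s with
  | leaf => simp [Shape.size]
  | node c l r =>
    have := l.size_pos
    have := r.size_pos
    simp [Shape.size]
    omega

section Labellings

variable {ι κ : Type} [Fintype ι] [Fintype κ]

theorem image_card_le_of_factors {u w : ι → ℕ} (h : ∀ i j, u i = u j → w i = w j) :
    (Finset.univ.image w).card ≤ (Finset.univ.image u).card := by
  have hw : w = Function.extend u w 0 ∘ u := by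
    funext i
    exact (Function.FactorsThrough.extend_apply (fun a b hab => h a b hab) 0 i).symm
  rw [hw, ← Finset.image_image]
  exact Finset.card_image_le

theorem vars_congr {f g : ι → ℕ × Bool} (h : ker f = ker g) : vars f = vars g := by
  rw [ker_eq_iff] at h
  exact le_antisymm (image_card_le_of_factors fun i j => (h i j).1.2)
    (image_card_le_of_factors fun i j => (h i j).1.1)

theorem sgn_eq_sgn {b b' : Bool} {l l' : ℕ × Bool} :
    sgn b l = sgn b' l' ↔ l.1 = l'.1 ∧ (l = l' ↔ b = b') := by
  obtain ⟨v, s⟩ := l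
  obtain ⟨v', s'⟩ := l'
  cases s <;> cases s' <;> cases b <;> cases b' <;> simp [sgn]

theorem ncard_ker_collapse (V : ℕ → Prop) (e : κ → ι) (r : ι → κ) (σ : ι → Bool)
    (hr : ∀ k, r (e k) = k) (hσ : ∀ k, σ (e k) = false) :
    (ker '' {f : ι → ℕ × Bool | V (vars f) ∧ ∀ i, f i = sgn (σ i) (f (e (r i)))}).ncard =
      (ker '' {g : κ → ℕ × Bool | V (vars g)}).ncard := by
  have hvars : ∀ f : ι → ℕ × Bool, (∀ i, f i = sgn (σ i) (f (e (r i)))) →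
      vars f = vars fun k => f (e k) := by
    intro f hf
    unfold vars
    congr 1
    ext v
    simp only [Finset.mem_image, Finset.mem_univ, true_and]
    constructor
    · rintro ⟨i, rfl⟩
      exact ⟨r i, by rw [hf i]; rfl⟩
    · rintro ⟨k, rfl⟩
      exact ⟨e k, rfl⟩
  have himg : (fun (q : ι → ι → Prop × Prop) k k' => q (e k) (e k')) ''
      (ker '' {f : ι → ℕ × Bool | V (vars f) ∧ ∀ i, f i = sgn (σ i) (f (e (r i)))}) =
      ker '' {g : κ → ℕ × Bool | V (vars g)} := by
    ext q
    constructor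
    · rintro ⟨_, ⟨f, ⟨hV, hf⟩, rfl⟩, rfl⟩
      exact ⟨fun k => f (e k), by rwa [Set.mem_ofPred_eq, ← hvars f hf], rfl⟩
    · rintro ⟨g, hV, rfl⟩
      have hg : ∀ i, sgn (σ i) (g (r i)) =
          sgn (σ i) (sgn (σ (e (r i))) (g (r (e (r i))))) := by
        intro i
        rw [hσ, hr]
        simp [sgn]
      have hge : (fun k => sgn (σ (e k)) (g (r (e k)))) = g := by
        funext k
        rw [hσ, hr]
        simp [sgn]
      refine ⟨_, ⟨fun i => sgn (σ i) (g (r i)), ⟨?_, hg⟩, rfl⟩, ?_⟩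
      · rw [hvars _ hg, hge]
        exact hV
      · conv_rhs => rw [← hge]
        rfl
  rw [← himg]
  refine (Set.InjOn.ncard_image ?_).symm
  rintro _ ⟨f, ⟨-, hf⟩, rfl⟩ _ ⟨f', ⟨-, hf'⟩, rfl⟩ h
  rw [ker_eq_iff]
  intro i j
  have := ker_eq_iff (f := fun k => f (e k)) (g := fun k => f' (e k)) |>.1 h (r i) (r j)
  rw [hf i, hf j, hf' i, hf' j, sgn_eq_sgn, sgn_eq_sgn, this.1, this.2]
  exact ⟨this.1, Iff.rfl⟩

theorem ncard_ker_equiv (V : ℕ → Prop) (e : κ ≃ ι) :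
    (ker '' {f : ι → ℕ × Bool | V (vars f)}).ncard =
      (ker '' {g : κ → ℕ × Bool | V (vars g)}).ncard := by
  rw [← ncard_ker_collapse V e e.symm (fun _ => false) e.symm_apply_apply fun _ => rfl]
  congr 2
  ext f
  simp [sgn]

theorem vars_option_new {f : Option ι → ℕ × Bool} (h : ∀ i, (f none).1 ≠ (f (some i)).1) :
    vars f = vars (fun i => f (some i)) + 1 := by
  have : (Finset.univ.image fun o => (f o).1) =
      insert (f none).1 (Finset.univ.image fun i => (f (some i)).1) := by
    ext v
    simp [Option.exists, eq_comm]
  rw [vars, vars, this, Finset.card_insert_of_notMem]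
  simpa [eq_comm] using h

theorem vars_option_old {f : Option ι → ℕ × Bool} {i : ι} (h : (f none).1 = (f (some i)).1) :
    vars f = vars (fun i => f (some i)) := by
  unfold vars
  congr 1
  ext v
  simp only [Finset.mem_image, Finset.mem_univ, true_and, Option.exists]
  constructor
  · rintro (rfl | h')
    · exact ⟨i, h.symm⟩
    · exact h'
  · exact Or.inr

theorem ncard_ker_new (p : ℕ) :
    (ker '' {f : Option ι → ℕ × Bool | vars f = p + 1 ∧
      ∀ i, (f none).1 ≠ (f (some i)).1}).ncard =
      (ker '' {g : ι → ℕ × Bool | vars g = p}).ncard := by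
  have himg : (fun (q : Option ι → Option ι → Prop × Prop) k k' => q (some k) (some k')) ''
      (ker '' {f : Option ι → ℕ × Bool | vars f = p + 1 ∧
      ∀ i, (f none).1 ≠ (f (some i)).1}) = ker '' {g : ι → ℕ × Bool | vars g = p} := by
    ext q
    constructor
    · rintro ⟨_, ⟨f, ⟨hV, hf⟩, rfl⟩, rfl⟩
      refine ⟨fun k => f (some k), ?_, rfl⟩
      rw [vars_option_new hf] at hV
      exact Nat.succ_injective hV
    · rintro ⟨g, hV, rfl⟩
      obtain ⟨v, hv⟩ := Infinite.exists_notMem_finset (Finset.univ.image fun i => (g i).1)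
      have hv' : ∀ i, v ≠ (g i).1 := by simpa [eq_comm] using hv
      refine ⟨_, ⟨fun o => o.elim (v, true) g, ⟨?_, hv'⟩, rfl⟩, rfl⟩
      rw [vars_option_new hv']
      exact congrArg (· + 1) hV
  rw [← himg]
  refine (Set.InjOn.ncard_image ?_).symm
  rintro _ ⟨f, ⟨-, hf⟩, rfl⟩ _ ⟨f', ⟨-, hf'⟩, rfl⟩ h
  have h' := ker_eq_iff (f := fun k => f (some k)) (g := fun k => f' (some k)) |>.1 h
  rw [ker_eq_iff]
  have hl : ∀ i, f none ≠ f (some i) := fun i h => hf i (congrArg Prod.fst h)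
  have hl' : ∀ i, f' none ≠ f' (some i) := fun i h => hf' i (congrArg Prod.fst h)
  rintro (_ | i) (_ | j)
  · simp
  · simp [hf, hf', hl, hl']
  · simp [hf, hf', hl, hl', eq_comm (b := f none), eq_comm (b := f' none),
      eq_comm (b := (f none).1), eq_comm (b := (f' none).1)]
  · exact h' i j

theorem ncard_ker_old (p : ℕ) :
    (ker '' {f : Option ι → ℕ × Bool | vars f = p ∧
      ∃ i, (f none).1 = (f (some i)).1}).ncard =
      2 * p * (ker '' {g : ι → ℕ × Bool | vars g = p}).ncard := by
  classical
  let T := (Set.toFinite (ker '' {g : ι → ℕ × Bool | vars g = p})).toFinset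
  have hT : ∀ q : ι → ι → Prop × Prop, ∃ g : ι → ℕ × Bool, q ∈ T → vars g = p ∧ ker g = q := by
    intro q
    by_cases hq : q ∈ T
    · obtain ⟨g, hg, rfl⟩ := (Set.Finite.mem_toFinset _).1 hq
      exact ⟨g, fun _ => ⟨hg, rfl⟩⟩
    · exact ⟨fun _ => (0, true), fun h => absurd h hq⟩
  choose g hg using hT
  let U := T.sigma fun q => (Finset.univ.image fun i => (g q i).1) ×ˢ (Finset.univ : Finset Bool)
  let F : (_ : ι → ι → Prop × Prop) × (ℕ × Bool) → (Option ι → Option ι → Prop × Prop) :=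
    fun u => ker fun o => o.elim u.2 (g u.1)
  have hU : U.card = 2 * p * T.card := by
    rw [Finset.card_sigma, Finset.sum_congr rfl (g := fun _ => p * 2), Finset.sum_const,
      smul_eq_mul]
    · ring
    · intro q hq
      rw [Finset.card_product, ← (hg q hq).1]
      rfl
  have hF : ker '' {f : Option ι → ℕ × Bool | vars f = p ∧
      ∃ i, (f none).1 = (f (some i)).1} = U.image F := by
    ext q
    simp only [Finset.coe_image, Set.mem_image, Finset.mem_coe]
    constructor
    · rintro ⟨f, ⟨hp, i, hi⟩, rfl⟩
      have hm : ker (fun i => f (some i)) ∈ T :=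
        (Set.Finite.mem_toFinset _).2 ⟨_, (vars_option_old hi).symm.trans hp, rfl⟩
      have hk := ker_eq_iff.1 (hg _ hm).2
      refine ⟨⟨ker (fun i => f (some i)),
        sgn ((f none).2 ^^ (f (some i)).2) (g (ker fun i => f (some i)) i)⟩, ?_, ?_⟩
      · simp only [U, Finset.mem_sigma, Finset.mem_product, Finset.mem_image, Finset.mem_univ,
          true_and, and_true]
        exact ⟨hm, i, rfl⟩
      · have key : ∀ j, ((g (ker fun i => f (some i)) i).1 = (g (ker fun i => f (some i)) j).1 ↔
            (f none).1 = (f (some j)).1) ∧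
            (sgn ((f none).2 ^^ (f (some i)).2) (g (ker fun i => f (some i)) i) =
              g (ker fun i => f (some i)) j ↔ f none = f (some j)) := by
          intro j
          refine ⟨by rw [hi]; exact (hk i j).1, ?_⟩
          have h1 : f none = sgn ((f none).2 ^^ (f (some i)).2) (f (some i)) := by
            ext1
            · exact hi
            · simp only [sgn]
              cases (f none).2 <;> cases (f (some i)).2 <;> rfl
          have h2 : ∀ l : ℕ × Bool, l = sgn false l := fun l => by simp [sgn]
          rw [h2 (g _ j), sgn_eq_sgn, (hk i j).1, (hk i j).2]
          conv_rhs => rw [h1, h2 (f (some j)), sgn_eq_sgn]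
        refine ker_eq_iff.2 ?_
        rintro (_ | j) (_ | j')
        · simp
        · exact key j'
        · refine ⟨?_, ?_⟩
          · rw [eq_comm, eq_comm (a := (f (some j)).1)]
            exact (key j).1
          · rw [eq_comm, eq_comm (a := f (some j))]
            exact (key j).2
        · exact hk j j'
    · rintro ⟨⟨q, l⟩, hu, rfl⟩
      simp only [U, Finset.mem_sigma, Finset.mem_product, Finset.mem_image, Finset.mem_univ,
        true_and, and_true] at hu
      obtain ⟨hq, i, hi⟩ := hu
      refine ⟨_, ⟨?_, i, hi.symm⟩, rfl⟩
      rw [vars_option_old hi.symm]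
      exact (hg q hq).1
  rw [hF, Set.ncard_coe_finset, Finset.card_image_of_injOn, hU, ← Set.ncard_eq_toFinset_card]
  rintro ⟨q, l⟩ hu ⟨q', l'⟩ hu' h
  simp only [U, Finset.mem_coe, Finset.mem_sigma, Finset.mem_product, Finset.mem_image,
    Finset.mem_univ, true_and, and_true] at hu hu'
  obtain ⟨hq, i, hi⟩ := hu
  have h' := ker_eq_iff.1 h
  obtain rfl : q = q' := by
    rw [← (hg q hq).2, ← (hg q' hu'.1).2]
    exact ker_eq_iff.2 fun i j => h' (some i) (some j)
  have hv : l.1 = l'.1 := by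
    have := (h' none (some i)).1
    simp only [Option.elim] at this
    rw [← hi, ← this.1 hi.symm]
  have hl := (h' none (some i)).2
  simp only [Option.elim] at hl
  obtain ⟨v, b⟩ := l
  obtain ⟨v', b'⟩ := l'
  simp only at hv hi
  subst hv
  have : ∀ b, ((v, b) = g q i ↔ b = (g q i).2) := fun b => by
    rw [Prod.ext_iff]
    exact and_iff_right hi.symm
  rw [this, this] at hl
  have : b = b' := by
    revert hl
    cases b <;> cases b' <;> cases (g q i).2 <;> simp
  rw [this]

theorem ncard_ker_option (p : ℕ) :
    (ker '' {f : Option ι → ℕ × Bool | vars f = p + 1}).ncard =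
      (ker '' {g : ι → ℕ × Bool | vars g = p}).ncard +
      2 * (p + 1) * (ker '' {g : ι → ℕ × Bool | vars g = p + 1}).ncard := by
  rw [← ncard_ker_new p, ← ncard_ker_old (p + 1), ← Set.ncard_union_eq, ← Set.image_union]
  · congr 2
    ext f
    simp only [Set.mem_ofPred_eq, Set.mem_union]
    by_cases h : ∃ i, (f none).1 = (f (some i)).1
    · simp [h]
    · simp [not_exists.1 h]
  · rw [Set.disjoint_left]
    rintro _ ⟨f, ⟨-, hf⟩, rfl⟩ ⟨f', ⟨-, i, hi⟩, h⟩
    exact hf i ((ker_eq_iff.1 h none (some i)).1.1 hi)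

end Labellings

theorem ncard_ker_fin (n p : ℕ) :
    2 ^ p * (ker '' {f : Fin n → ℕ × Bool | vars f = p}).ncard = 2 ^ n * stirling n p := by
  induction n generalizing p with
  | zero =>
    have h : ∀ f : Fin 0 → ℕ × Bool, vars f = 0 := fun f => by simp [vars]
    cases p with
    | zero =>
      have : {f : Fin 0 → ℕ × Bool | vars f = 0} = Set.univ := Set.eq_univ_of_forall h
      rw [this, Set.image_univ, Set.range_unique, Set.ncard_singleton]
      simp [stirling]
    | succ p => simp [h, stirling]
  | succ n ih =>
    rw [ncard_ker_equiv (· = p) (finSuccEquiv n).symm]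
    cases p with
    | zero =>
      have : {f : Option (Fin n) → ℕ × Bool | vars f = 0} = ∅ := by
        ext f
        simp [vars, Finset.univ_eq_empty_iff]
      rw [this]
      simp [stirling]
    | succ p =>
      rw [ncard_ker_option, stirling, pow_succ 2 n]
      have h1 := ih p
      have h2 := ih (p + 1)
      calc _ = 2 * (2 ^ p * (ker '' {f : Fin n → ℕ × Bool | vars f = p}).ncard) +
          2 * (p + 1) *
            (2 ^ (p + 1) * (ker '' {f : Fin n → ℕ × Bool | vars f = p + 1}).ncard) := by ring
        _ = _ := by rw [h1, h2]; ring

/-- The number of classes of labellings of `n` leaves with at most `K` variables. -/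
noncomputable def labCount (n K : ℕ) : ℝ := 2 ^ n * B n K

theorem stirling_zero_right (n : ℕ) : stirling (n + 1) 0 = 0 := rfl

theorem ncard_ker_le {ι : Type} [Fintype ι] {n : ℕ} (hn : n ≠ 0) (h : Fintype.card ι = n)
    (K : ℕ) :
    ((ker '' {f : ι → ℕ × Bool | vars f ≤ K}).ncard : ℝ) = labCount n K := by
  have hf : (ker '' {f : Fin n → ℕ × Bool | vars f ≤ K}).ncard =
      ∑ p ∈ Finset.range (K + 1), (ker '' {f : Fin n → ℕ × Bool | vars f = p}).ncard := by
    induction K with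
    | zero => simp
    | succ K ih =>
      rw [Finset.sum_range_succ, ← ih, ← Set.ncard_union_eq, ← Set.image_union]
      · congr 2
        ext f
        simp only [Set.mem_ofPred_eq, Set.mem_union]
        omega
      · rw [Set.disjoint_left]
        rintro _ ⟨f, hf, rfl⟩ ⟨f', hf', h⟩
        have := vars_congr h
        simp only [Set.mem_ofPred_eq] at hf hf'
        omega
  rw [ncard_ker_equiv (· ≤ K) (Fintype.equivFinOfCardEq h).symm, hf, labCount, B, Nat.cast_sum,
    Finset.mul_sum, Finset.range_eq_Ico, Finset.sum_eq_sum_Ico_succ_bot (Nat.succ_pos K)]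
  have h2 : ∀ p, ((ker '' {f : Fin n → ℕ × Bool | vars f = p}).ncard : ℝ) =
      2 ^ n * (stirling n p / 2 ^ p) := by
    intro p
    rw [mul_div_assoc', eq_div_iff (by positivity), mul_comm]
    exact_mod_cast ncard_ker_fin n p
  obtain ⟨m, rfl⟩ := Nat.exists_eq_succ_of_ne_zero hn
  simp only [h2, stirling_zero_right, Nat.cast_zero, zero_div, mul_zero, zero_add]
  rfl

theorem eq_sgn_congr {ι : Type} {f g : ι → ℕ × Bool} (h : ker f = ker g) (b : Bool) (p q : ι) :
    f p = sgn b (f q) ↔ g p = sgn b (g q) := by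
  have h0 : ∀ l : ℕ × Bool, l = sgn false l := fun l => by simp [sgn]
  have := ker_eq_iff.1 h p q
  rw [h0 (f p), h0 (g p), sgn_eq_sgn, sgn_eq_sgn, this.1, this.2]

section Collisions

variable {ι : Type} [Fintype ι] [DecidableEq ι]

theorem ncard_ker_pair {n K : ℕ} (hn : n ≠ 0) (h : Fintype.card ι = n + 1) {i j : ι} (hij : i ≠ j)
    (b : Bool) :
    ((ker '' {f : ι → ℕ × Bool | vars f ≤ K ∧ f i = sgn b (f j)}).ncard : ℝ) = labCount n K := by
  rw [← ncard_ker_le (ι := {x : ι // x ≠ i}) hn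
    (by rw [Fintype.card_subtype_compl, h, Fintype.card_subtype_eq]; rfl) K,
    ← ncard_ker_collapse (· ≤ K) Subtype.val
      (fun x => if h : x ≠ i then ⟨x, h⟩ else ⟨j, hij.symm⟩)
      (fun x => if x = i then b else false) (fun k => by simp [k.2]) (fun k => by simp [k.2])]
  congr 4
  ext f
  refine and_congr_right fun _ => ⟨fun hf x => ?_, fun hf => ?_⟩
  · by_cases hx : x = i
    · subst hx
      simpa using hf
    · simp [hx, sgn]
  · simpa using hf i

theorem ncard_ker_two_pairs {n K : ℕ} (hn : n ≠ 0) (h : Fintype.card ι = n + 2) {i j i' j' : ι}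
    (hjj : j ≠ j') (hij : i ≠ j) (hij' : i ≠ j') (hi'j : i' ≠ j) (hi'j' : i' ≠ j') :
    ((ker '' {f : ι → ℕ × Bool | vars f ≤ K ∧ (f i).1 = (f j).1 ∧ (f i').1 = (f j').1}).ncard : ℝ)
      ≤ 4 * labCount n K := by
  have hb : ∀ b : Bool × Bool, ((ker '' {f : ι → ℕ × Bool | vars f ≤ K ∧
      f j = sgn b.1 (f i) ∧ f j' = sgn b.2 (f i')}).ncard : ℝ) = labCount n K := by
    intro b
    have hc : Fintype.card {x : ι // ¬ (x = j ∨ x = j')} = n := by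
      rw [Fintype.card_subtype_compl, h]
      have : Fintype.card {x : ι // x = j ∨ x = j'} = 2 := by
        rw [Fintype.card_subtype, ← Finset.card_pair hjj]
        congr 1
        ext x
        simp
      omega
    rw [← ncard_ker_le (ι := {x : ι // ¬ (x = j ∨ x = j')}) hn hc K,
      ← ncard_ker_collapse (· ≤ K) Subtype.val
      (fun x => if h : ¬ (x = j ∨ x = j') then ⟨x, h⟩ else
        if x = j then ⟨i, by simp [hij, hij']⟩ else ⟨i', by simp [hi'j, hi'j']⟩)
      (fun x => if x = j then b.1 else if x = j' then b.2 else false)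
      (fun k => by simp [k.2]) (fun k => by have := not_or.1 k.2; simp [this.1, this.2])]
    congr 4
    ext f
    refine and_congr_right fun _ => ⟨fun hf x => ?_, fun hf => ⟨?_, ?_⟩⟩
    · by_cases hx : x = j
      · subst hx
        simpa using hf.1
      · by_cases hx' : x = j'
        · subst hx'
          simpa [hx] using hf.2
        · simp [hx, hx', sgn]
    · simpa using hf j
    · simpa [hjj.symm] using hf j'
  have hsub : ker '' {f : ι → ℕ × Bool | vars f ≤ K ∧ (f i).1 = (f j).1 ∧ (f i').1 = (f j').1} ⊆
      ⋃ b ∈ (Finset.univ : Finset (Bool × Bool)), ker '' {f : ι → ℕ × Bool | vars f ≤ K ∧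
      f j = sgn b.1 (f i) ∧ f j' = sgn b.2 (f i')} := by
    rintro _ ⟨f, ⟨hK, h1, h2⟩, rfl⟩
    have key : ∀ p q, (f p).1 = (f q).1 → f q = sgn ((f p).2 ^^ (f q).2) (f p) := by
      intro p q hpq
      ext1
      · exact hpq.symm
      · simp only [sgn]
        cases (f p).2 <;> cases (f q).2 <;> rfl
    exact Set.mem_biUnion (Finset.mem_coe.2 (Finset.mem_univ
      (((f i).2 ^^ (f j).2), ((f i').2 ^^ (f j').2)))) ⟨f, ⟨hK, key _ _ h1, key _ _ h2⟩, rfl⟩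
  calc _ ≤ ((⋃ b ∈ (Finset.univ : Finset (Bool × Bool)), ker '' {f : ι → ℕ × Bool | vars f ≤ K ∧
      f j = sgn b.1 (f i) ∧ f j' = sgn b.2 (f i')}).ncard : ℝ) := by
        exact_mod_cast Set.ncard_le_ncard hsub (Set.toFinite _)
    _ ≤ ∑ b : Bool × Bool, ((ker '' {f : ι → ℕ × Bool | vars f ≤ K ∧
      f j = sgn b.1 (f i) ∧ f j' = sgn b.2 (f i')}).ncard : ℝ) := by
        exact_mod_cast Finset.set_ncard_biUnion_le _ _
    _ = 4 * labCount n K := by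
        rw [Finset.sum_congr rfl fun b _ => hb b]
        simp

/-- At most one pair of positions in `S` carry the same variable. -/
def OneColl (S : Finset ι) (f : ι → ℕ × Bool) : Prop :=
  ∀ a ∈ S, ∀ b ∈ S, ∀ c ∈ S, ∀ d ∈ S, a ≠ b → c ≠ d → (f a).1 = (f b).1 → (f c).1 = (f d).1 →
    (a = c ∧ b = d) ∨ (a = d ∧ b = c)

theorem labCount_nonneg (n K : ℕ) : 0 ≤ labCount n K :=
  mul_nonneg (by positivity) (Finset.sum_nonneg fun _ _ => by positivity)

theorem ncard_ker_not_oneColl {n K : ℕ} (hn : n ≠ 0) (h : Fintype.card ι = n + 2) (S : Finset ι) :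
    ((ker '' {f : ι → ℕ × Bool | vars f ≤ K ∧ ¬ OneColl S f}).ncard : ℝ) ≤
      4 * (S.card : ℝ) ^ 4 * labCount n K := by
  let good : Finset (ι × ι × ι × ι) := (S ×ˢ S ×ˢ S ×ˢ S).filter fun t =>
    t.2.1 ≠ t.2.2.2 ∧ t.1 ≠ t.2.1 ∧ t.1 ≠ t.2.2.2 ∧ t.2.2.1 ≠ t.2.1 ∧ t.2.2.1 ≠ t.2.2.2
  have hsub : ker '' {f : ι → ℕ × Bool | vars f ≤ K ∧ ¬ OneColl S f} ⊆
      ⋃ t ∈ good, ker '' {f : ι → ℕ × Bool | vars f ≤ K ∧ (f t.1).1 = (f t.2.1).1 ∧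
        (f t.2.2.1).1 = (f t.2.2.2).1} := by
    rintro _ ⟨f, ⟨hK, hf⟩, rfl⟩
    simp only [OneColl, not_forall] at hf
    obtain ⟨a, ha, b, hb, c, hc, d, hd, hab, hcd, h1, h2, h3⟩ := hf
    have : ∃ t ∈ good, (f t.1).1 = (f t.2.1).1 ∧ (f t.2.2.1).1 = (f t.2.2.2).1 := by
      have hmk : ∀ i j i' j' : ι, i ∈ S → j ∈ S → i' ∈ S → j' ∈ S →
          (j ≠ j' ∧ i ≠ j ∧ i ≠ j' ∧ i' ≠ j ∧ i' ≠ j') → (f i).1 = (f j).1 →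
          (f i').1 = (f j').1 →
          ∃ t ∈ good, (f t.1).1 = (f t.2.1).1 ∧ (f t.2.2.1).1 = (f t.2.2.2).1 := by
        intro i j i' j' hi hj hi' hj' hne e1 e2
        exact ⟨(i, j, i', j'), Finset.mem_filter.2
          ⟨by simp only [Finset.mem_product]; exact ⟨hi, hj, hi', hj'⟩, hne⟩, e1, e2⟩
      by_cases hac : a = c
      · subst hac
        exact hmk a b a d ha hb ha hd (by grind) h1 h2
      by_cases had : a = d
      · subst had
        exact hmk a b a c ha hb ha hc (by grind) h1 h2.symm
      by_cases hbc : b = c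
      · subst hbc
        exact hmk b a b d hb ha hb hd (by grind) h1.symm h2
      by_cases hbd : b = d
      · subst hbd
        exact hmk b a b c hb ha hb hc (by grind) h1.symm h2.symm
      exact hmk a b c d ha hb hc hd (by grind) h1 h2
    obtain ⟨t, ht, h⟩ := this
    exact Set.mem_biUnion (Finset.mem_coe.2 ht) ⟨f, ⟨hK, h⟩, rfl⟩
  calc _ ≤ ((⋃ t ∈ good, ker '' {f : ι → ℕ × Bool | vars f ≤ K ∧ (f t.1).1 = (f t.2.1).1 ∧
        (f t.2.2.1).1 = (f t.2.2.2).1}).ncard : ℝ) := by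
        exact_mod_cast Set.ncard_le_ncard hsub (Set.toFinite _)
    _ ≤ ∑ t ∈ good, ((ker '' {f : ι → ℕ × Bool | vars f ≤ K ∧ (f t.1).1 = (f t.2.1).1 ∧
        (f t.2.2.1).1 = (f t.2.2.2).1}).ncard : ℝ) := by
        exact_mod_cast Finset.set_ncard_biUnion_le _ _
    _ ≤ ∑ t ∈ good, 4 * labCount n K := by
        refine Finset.sum_le_sum fun t ht => ?_
        obtain ⟨-, h1, h2, h3, h4, h5⟩ := Finset.mem_filter.1 ht
        exact ncard_ker_two_pairs hn h h1 h2 h3 h4 h5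
    _ ≤ 4 * (S.card : ℝ) ^ 4 * labCount n K := by
        rw [Finset.sum_const, nsmul_eq_mul]
        have : (good.card : ℝ) ≤ (S.card : ℝ) ^ 4 := by
          have := Finset.card_filter_le (S ×ˢ S ×ˢ S ×ˢ S) fun t =>
            t.2.1 ≠ t.2.2.2 ∧ t.1 ≠ t.2.1 ∧ t.1 ≠ t.2.2.2 ∧ t.2.2.1 ≠ t.2.1 ∧ t.2.2.1 ≠ t.2.2.2
          simp only [Finset.card_product] at this
          calc (good.card : ℝ) ≤ ((S.card * (S.card * (S.card * S.card)) : ℕ) : ℝ) := by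
                exact_mod_cast this
            _ = _ := by push_cast; ring
        nlinarith [mul_le_mul_of_nonneg_right this (labCount_nonneg n K)]

/-- A position of `Λ` has the label of `o`, or two positions of `Λ` have opposite labels. -/
def Expands (o : ι) (Λ : Finset ι) (f : ι → ℕ × Bool) : Prop :=
  (∃ i ∈ Λ, ∃ j ∈ Λ, f i = sgn true (f j)) ∨ ∃ i ∈ Λ, f i = f o

theorem ncard_ker_expands {n K : ℕ} (hn : n ≠ 0) (h : Fintype.card ι = n + 2) {o : ι}
    {Λ S : Finset ι} (ho : o ∉ Λ) (hS : insert o Λ ⊆ S) :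
    2 * ((ker '' {f : ι → ℕ × Bool | vars f ≤ K ∧ Expands o Λ f}).ncard : ℝ) ≤
        (Λ.card * (Λ.card + 1) : ℕ) * labCount (n + 1) K ∧
      (Λ.card * (Λ.card + 1) : ℕ) * labCount (n + 1) K ≤
        2 * ((ker '' {f : ι → ℕ × Bool | vars f ≤ K ∧ Expands o Λ f}).ncard : ℝ) +
          4 * (S.card : ℝ) ^ 6 * labCount n K := by
  classical
  let tag : ι × ι → Bool := fun e => decide (e.1 ≠ o ∧ e.2 ≠ o)
  let Q := (Set.toFinite (ker '' {f : ι → ℕ × Bool | vars f ≤ K})).toFinset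
  let X : (ι → ι → Prop × Prop) → ℕ := fun q => ((insert o Λ).offDiag.filter fun e =>
    q ∈ ker '' {f : ι → ℕ × Bool | vars f ≤ K ∧ f e.1 = sgn (tag e) (f e.2)}).card
  have hcount : ∀ P : (ι → ℕ × Bool) → Prop,
      (ker '' {f : ι → ℕ × Bool | vars f ≤ K ∧ P f}).ncard =
      ∑ q ∈ Q, if q ∈ ker '' {f : ι → ℕ × Bool | vars f ≤ K ∧ P f} then 1 else 0 := by
    intro P
    rw [← Finset.card_filter, ← Set.ncard_coe_finset]
    congr 1
    ext q
    simp only [Q, Finset.coe_filter, Set.Finite.mem_toFinset, Set.mem_ofPred_eq]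
    refine ⟨fun hq => ⟨?_, hq⟩, fun hq => hq.2⟩
    obtain ⟨f, hf, rfl⟩ := hq
    exact ⟨f, hf.1, rfl⟩
  have hoff : (insert o Λ).offDiag.card = Λ.card * (Λ.card + 1) := by
    rw [Finset.offDiag_card, Finset.card_insert_of_notMem ho]
    have : (Λ.card + 1) * (Λ.card + 1) = Λ.card * (Λ.card + 1) + (Λ.card + 1) := by ring
    omega
  have hsum : ((Λ.card * (Λ.card + 1) : ℕ) : ℝ) * labCount (n + 1) K = ∑ q ∈ Q, (X q : ℝ) := by
    have h1 : ∑ e ∈ (insert o Λ).offDiag, ((ker '' {f : ι → ℕ × Bool | vars f ≤ K ∧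
        f e.1 = sgn (tag e) (f e.2)}).ncard : ℝ) = ∑ q ∈ Q, (X q : ℝ) := by
      simp only [hcount, X, Finset.card_filter]
      push_cast
      exact Finset.sum_comm
    rw [← h1, Finset.sum_congr rfl fun e he => ncard_ker_pair (Nat.succ_ne_zero n) h
      (Finset.mem_offDiag.1 he).2.2 (tag e), Finset.sum_const, nsmul_eq_mul, hoff]
  have hmem : ∀ (f : ι → ℕ × Bool), vars f ≤ K → ∀ e : ι × ι,
      (ker f ∈ ker '' {f : ι → ℕ × Bool | vars f ≤ K ∧ f e.1 = sgn (tag e) (f e.2)} ↔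
        f e.1 = sgn (tag e) (f e.2)) := by
    intro f hf e
    refine ⟨?_, fun he => ⟨f, ⟨hf, he⟩, rfl⟩⟩
    rintro ⟨g, ⟨-, hg⟩, hgf⟩
    exact (eq_sgn_congr hgf _ _ _).1 hg
  have hsymm : ∀ (f : ι → ℕ × Bool) (a b : ι), f a = sgn (tag (a, b)) (f b) →
      f b = sgn (tag (b, a)) (f a) := by
    intro f a b hab
    have : tag (b, a) = tag (a, b) := by simp only [tag, and_comm]
    rw [this, hab]
    simp [sgn]
  have hlow : ∀ q ∈ Q, 2 * (if q ∈ ker '' {f : ι → ℕ × Bool | vars f ≤ K ∧ Expands o Λ f}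
      then 1 else 0) ≤ X q := by
    intro q hq
    split_ifs with hex
    · obtain ⟨f, ⟨hf, hex⟩, rfl⟩ := hex
      obtain ⟨a, b, hab, he⟩ : ∃ a b, (a, b) ∈ (insert o Λ).offDiag ∧
          f a = sgn (tag (a, b)) (f b) := by
        rcases hex with ⟨i, hi, j, hj, hij⟩ | ⟨i, hi, hij⟩
        · refine ⟨i, j, Finset.mem_offDiag.2 ⟨Finset.mem_insert_of_mem hi,
            Finset.mem_insert_of_mem hj, ?_⟩, ?_⟩
          · rintro h
            simp only at h
            subst h
            simp [sgn, Prod.ext_iff] at hij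
          · have h1 : i ≠ o := fun h => ho (h ▸ hi)
            have h2 : j ≠ o := fun h => ho (h ▸ hj)
            simpa [tag, h1, h2] using hij
        · refine ⟨i, o, Finset.mem_offDiag.2 ⟨Finset.mem_insert_of_mem hi,
            Finset.mem_insert_self _ _, fun h : i = o => ho (h ▸ hi)⟩, ?_⟩
          simpa [tag, sgn] using hij
      have hne : a ≠ b := (Finset.mem_offDiag.1 hab).2.2
      have : ({(a, b), (b, a)} : Finset (ι × ι)) ⊆ (insert o Λ).offDiag.filter fun e =>
          ker f ∈ ker '' {f : ι → ℕ × Bool | vars f ≤ K ∧ f e.1 = sgn (tag e) (f e.2)} := by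
        intro e he
        rw [Finset.mem_filter, hmem f hf]
        rw [Finset.mem_insert, Finset.mem_singleton] at he
        rcases he with rfl | rfl
        · exact ⟨hab, he⟩
        · obtain ⟨h1, h2, h3⟩ := Finset.mem_offDiag.1 hab
          exact ⟨Finset.mem_offDiag.2 ⟨h2, h1, h3.symm⟩, hsymm f a b he⟩
      have hc := Finset.card_le_card this
      rwa [Finset.card_pair (by simp [hne])] at hc
    · exact Nat.zero_le _
  have hupp : ∀ q ∈ Q, X q ≤ 2 * (if q ∈ ker '' {f : ι → ℕ × Bool | vars f ≤ K ∧ Expands o Λ f}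
      then 1 else 0) + S.card ^ 2 *
      (if q ∈ ker '' {f : ι → ℕ × Bool | vars f ≤ K ∧ ¬ OneColl S f} then 1 else 0) := by
    intro q hq
    by_cases hbad : q ∈ ker '' {f : ι → ℕ × Bool | vars f ≤ K ∧ ¬ OneColl S f}
    · rw [if_pos hbad, mul_one]
      refine le_trans ((Finset.card_filter_le _ _).trans ?_) (Nat.le_add_left _ _)
      rw [Finset.offDiag_card, sq]
      exact (Nat.sub_le _ _).trans
        (Nat.mul_le_mul (Finset.card_le_card hS) (Finset.card_le_card hS))
    · obtain ⟨f, hf, rfl⟩ := (Set.Finite.mem_toFinset _).1 hq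
      have hone : OneColl S f := by
        by_contra hcon
        exact hbad ⟨f, ⟨hf, hcon⟩, rfl⟩
      rw [if_neg hbad, mul_zero, add_zero]
      by_cases hX : ∃ e ∈ (insert o Λ).offDiag, f e.1 = sgn (tag e) (f e.2)
      · obtain ⟨⟨a, b⟩, he, hab⟩ := hX
        simp only at hab
        obtain ⟨ha, hb, hne⟩ := Finset.mem_offDiag.1 he
        simp only at ha hb hne
        have hex : Expands o Λ f := by
          by_cases hao : a = o
          · subst hao
            have hb' := Finset.mem_of_mem_insert_of_ne hb hne.symm
            refine Or.inr ⟨b, hb', ?_⟩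
            simpa [tag, sgn] using hab.symm
          · have ha' := Finset.mem_of_mem_insert_of_ne ha hao
            by_cases hbo : b = o
            · subst hbo
              refine Or.inr ⟨a, ha', ?_⟩
              simpa [tag, sgn] using hab
            · have hb' := Finset.mem_of_mem_insert_of_ne hb hbo
              refine Or.inl ⟨a, ha', b, hb', ?_⟩
              simpa [tag, hao, hbo] using hab
        rw [if_pos ⟨f, ⟨hf, hex⟩, rfl⟩, mul_one]
        refine le_trans (Finset.card_le_card (t := {(a, b), (b, a)}) ?_) Finset.card_le_two
        rintro ⟨c, d⟩ he'
        rw [Finset.mem_filter, hmem f hf] at he'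
        obtain ⟨hc, hd, hne'⟩ := Finset.mem_offDiag.1 he'.1
        have := hone a (hS ha) b (hS hb) c (hS hc) d (hS hd) hne hne' (by rw [hab]; rfl)
          (by rw [he'.2]; rfl)
        simp only [Finset.mem_insert, Finset.mem_singleton, Prod.mk.injEq]
        grind
      · rw [show X (ker f) = 0 from ?_]
        · exact Nat.zero_le _
        · refine Finset.card_eq_zero.2 (Finset.filter_eq_empty_iff.2 fun e he h' => hX ⟨e, he, ?_⟩)
          exact (hmem f hf e).1 h'
  have hbad := ncard_ker_not_oneColl (K := K) hn h S
  rw [hsum]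
  constructor
  · rw [hcount, Nat.cast_sum, Finset.mul_sum]
    exact Finset.sum_le_sum fun q hq => by exact_mod_cast hlow q hq
  · calc ∑ q ∈ Q, (X q : ℝ) ≤ 2 * ((ker '' {f : ι → ℕ × Bool | vars f ≤ K ∧
          Expands o Λ f}).ncard : ℝ) + (S.card : ℝ) ^ 2 * ((ker '' {f : ι → ℕ × Bool |
          vars f ≤ K ∧ ¬ OneColl S f}).ncard : ℝ) := by
          rw [hcount, hcount, Nat.cast_sum, Nat.cast_sum, Finset.mul_sum, Finset.mul_sum,
            ← Finset.sum_add_distrib]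
          exact Finset.sum_le_sum fun q hq => by exact_mod_cast hupp q hq
      _ ≤ _ := by
          have := mul_le_mul_of_nonneg_left hbad (sq_nonneg (S.card : ℝ))
          linarith

end Collisions

theorem Conn.dual_ne (c : Conn) : c.dual ≠ c := by cases c <;> simp [Conn.dual]

theorem Conn.val_dual (c : Conn) : c.dual.val = !c.val := by cases c <;> rfl

theorem Conn.eq_dual_of_ne {c d : Conn} (h : d ≠ c) : d = c.dual := by
  cases c <;> cases d <;> simp_all [Conn.dual]

/-- The leaves linked to the root by internal nodes labelled `c` only. -/
def pathSet (c : Conn) : (s : Shape) → Finset (Pos s)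
  | .leaf => Finset.univ
  | .node d l r => if d = c then Pos.join (pathSet c l) (pathSet c r) else ∅

/-- A set of leaves whose values at the neutral value of `c` force that value at the root. -/
def pat (c : Conn) : (s : Shape) → Finset (Pos s)
  | .leaf => Finset.univ
  | .node d l r => Pos.join (pat c l) (if d = c then pat c r else ∅)

/-- A set of leaves containing, for each leaf outside `pathSet c`, a forcing set avoiding it. -/
def altPat (c : Conn) : (s : Shape) → Finset (Pos s)
  | .leaf => Finset.univ
  | .node d l r =>
    if d = c then Pos.join (altPat c l) (altPat c r) else Pos.join (pat c l) (pat c r)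

/-- The union of the forcing sets of the two subtrees of the root. -/
def childPat (c : Conn) : (s : Shape) → Finset (Pos s)
  | .leaf => Finset.univ
  | .node _ l r => Pos.join (pat c l) (pat c r)

/-- The leaves inspected when deciding whether a tree computes a literal. -/
noncomputable def scope : (s : Shape) → Finset (Pos s)
  | .leaf => Finset.univ
  | .node c l r => Pos.join (altPat c.dual l ∪ childPat c l) (altPat c.dual r ∪ childPat c r)

/-- Giving the leaves of `Q` the neutral value of `c` forces that value at the root. -/
def Forces (c : Conn) (s : Shape) (Q : Finset (Pos s)) : Prop :=
  ∀ g : Pos s → Bool, (∀ i ∈ Q, g i = c.val) → s.ev g = c.val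

section Forcing

variable {c : Conn} {l r : Shape}

theorem Pos.join_subset {A A' : Finset (Pos l)} {B B' : Finset (Pos r)} (hA : A ⊆ A')
    (hB : B ⊆ B') : (Pos.join A B : Finset (Pos (.node c l r))) ⊆ Pos.join A' B' := by
  rintro (_ | i | i) hi
  · exact Pos.inl_mem_join.2 (hA (Pos.inl_mem_join.1 hi))
  · exact Pos.inr_mem_join.2 (hB (Pos.inr_mem_join.1 hi))

theorem Forces.join {A : Finset (Pos l)} {B : Finset (Pos r)} (hA : Forces c l A)
    (hB : Forces c r B) : Forces c (.node c l r) (Pos.join A B) := by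
  intro g hg
  rw [Shape.ev, hA _ fun i hi => hg _ (Pos.inl_mem_join.2 hi),
    hB _ fun i hi => hg _ (Pos.inr_mem_join.2 hi)]
  cases c <;> rfl

theorem Forces.left {A : Finset (Pos l)} (hA : Forces c l A) (d : Conn) (hd : d ≠ c)
    (B : Finset (Pos r)) : Forces c (.node d l r) (Pos.join A B) := by
  intro g hg
  rw [Shape.ev, hA _ fun i hi => hg _ (Pos.inl_mem_join.2 hi)]
  cases c <;> cases d <;> simp_all [Conn.op, Conn.val]

theorem Forces.right {B : Finset (Pos r)} (hB : Forces c r B) (d : Conn) (hd : d ≠ c)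
    (A : Finset (Pos l)) : Forces c (.node d l r) (Pos.join A B) := by
  intro g hg
  rw [Shape.ev, hB _ fun i hi => hg _ (Pos.inr_mem_join.2 hi)]
  cases c <;> cases d <;> simp_all [Conn.op, Conn.val]

theorem forces_pat (c : Conn) (s : Shape) : Forces c s (pat c s) := by
  induction s with
  | leaf => exact fun g hg => hg _ (Finset.mem_univ _)
  | node d l r ihl ihr =>
    rw [pat]
    by_cases h : d = c
    · subst h
      simpa using ihl.join ihr
    · exact ihl.left d h _

theorem pat_subset_childPat (c : Conn) (s : Shape) : pat c s ⊆ childPat c s := by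
  cases s with
  | leaf => exact subset_rfl
  | node d l r =>
    refine Pos.join_subset subset_rfl ?_
    split_ifs
    · exact subset_rfl
    · exact Finset.empty_subset _

theorem pat_subset_altPat (c : Conn) (s : Shape) : pat c s ⊆ altPat c s := by
  induction s with
  | leaf => exact subset_rfl
  | node d l r ihl ihr =>
    rw [pat, altPat]
    split_ifs
    · exact Pos.join_subset ihl ihr
    · exact Pos.join_subset subset_rfl (Finset.empty_subset _)

theorem pathSet_subset_altPat (c : Conn) (s : Shape) : pathSet c s ⊆ altPat c s := by
  induction s with
  | leaf => exact subset_rfl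
  | node d l r ihl ihr =>
    rw [pathSet, altPat]
    split_ifs
    · exact Pos.join_subset ihl ihr
    · exact Finset.empty_subset _

theorem exists_forces_of_notMem_pathSet {s : Shape} {i : Pos s} (hi : i ∉ pathSet c s) :
    ∃ Q ⊆ altPat c s, i ∉ Q ∧ Forces c s Q := by
  induction i with
  | here => exact absurd (Finset.mem_univ _) hi
  | @inl d l r i ih =>
    by_cases h : d = c
    · subst h
      simp only [pathSet, if_true, Pos.inl_mem_join] at hi
      obtain ⟨Q, hQ, hiQ, hF⟩ := ih hi
      refine ⟨Pos.join Q (pat d r), ?_, by simpa using hiQ, hF.join (forces_pat _ _)⟩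
      rw [altPat, if_pos rfl]
      exact Pos.join_subset hQ (pat_subset_altPat _ _)
    · refine ⟨Pos.join ∅ (pat c r), ?_, by simp, (forces_pat _ _).right d h _⟩
      rw [altPat, if_neg h]
      exact Pos.join_subset (Finset.empty_subset _) subset_rfl
  | @inr d l r i ih =>
    by_cases h : d = c
    · subst h
      simp only [pathSet, if_true, Pos.inr_mem_join] at hi
      obtain ⟨Q, hQ, hiQ, hF⟩ := ih hi
      refine ⟨Pos.join (pat d l) Q, ?_, by simpa using hiQ, (forces_pat _ _).join hF⟩
      rw [altPat, if_pos rfl]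
      exact Pos.join_subset (pat_subset_altPat _ _) hQ
    · refine ⟨Pos.join (pat c l) ∅, ?_, by simp, (forces_pat _ _).left d h _⟩
      rw [altPat, if_neg h]
      exact Pos.join_subset subset_rfl (Finset.empty_subset _)

theorem exists_forces_of_mem_pathSet_dual {s : Shape} (hs : s ≠ .leaf) {i : Pos s}
    (hi : i ∈ pathSet c.dual s) : ∃ Q ⊆ childPat c s, i ∉ Q ∧ Forces c s Q := by
  cases i with
  | here => exact absurd rfl hs
  | @inl d l r i =>
    have hd : d ≠ c := by
      rintro rfl
      simp [pathSet, (Conn.dual_ne d).symm] at hi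
    exact ⟨Pos.join ∅ (pat c r), Pos.join_subset (Finset.empty_subset _) subset_rfl, by simp,
      (forces_pat _ _).right d hd _⟩
  | @inr d l r i =>
    have hd : d ≠ c := by
      rintro rfl
      simp [pathSet, (Conn.dual_ne d).symm] at hi
    exact ⟨Pos.join (pat c l) ∅, Pos.join_subset subset_rfl (Finset.empty_subset _), by simp,
      (forces_pat _ _).left d hd _⟩

theorem eq_of_mem_pat_of_mem_pathSet_dual {s : Shape} {i j : Pos s}
    (hi : i ∈ pathSet c.dual s) (hj : j ∈ pathSet c.dual s) (hi' : i ∈ pat c s)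
    (hj' : j ∈ pat c s) : i = j := by
  induction s with
  | leaf =>
    cases i
    cases j
    rfl
  | node d l r ihl ihr =>
    by_cases hd : d = c
    · subst hd
      simp [pathSet, (Conn.dual_ne d).symm] at hi
    · have hd' := Conn.eq_dual_of_ne hd
      simp only [pathSet, hd', if_true] at hi hj
      simp only [pat, hd, if_false] at hi' hj'
      cases i with
      | inr i => simp at hi'
      | inl i =>
        cases j with
        | inr j => simp at hj'
        | inl j =>
          simp only [Pos.inl_mem_join] at hi hj hi' hj'
          rw [ihl hi hj hi' hj']

end Forcing

/-- Two leaves of `Q` carry opposite literals. -/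
def Opp {ι : Type} (f : ι → ℕ × Bool) (Q : Finset ι) : Prop :=
  ∃ i ∈ Q, ∃ j ∈ Q, f i = sgn true (f j)

theorem sgn_true_ne (l : ℕ × Bool) : l ≠ sgn true l := by
  intro h
  simpa [sgn] using congrArg Prod.snd h

theorem fst_eq_of_eq_sgn {b : Bool} {l l' : ℕ × Bool} (h : l = sgn b l') : l.1 = l'.1 := by
  rw [h]
  rfl

theorem opp_or_mem_of_forces {c : Conn} {s : Shape} {f : Pos s → ℕ × Bool} {v : ℕ × Bool}
    (hev : ∀ x, s.ev (fun i => litVal (f i) x) = litVal v x) {Q : Finset (Pos s)}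
    (hQ : Forces c s Q) : Opp f Q ∨ ∃ i ∈ Q, f i = v := by
  classical
  by_contra! h
  obtain ⟨h1, h2⟩ := h
  let x : ℕ → Bool := fun u =>
    if u = v.1 then v.2 == !c.val else decide (∃ i ∈ Q, f i = (u, c.val))
  have hx := hev x
  rw [hQ] at hx
  · simp only [litVal, x, if_true] at hx
    revert hx
    cases c.val <;> cases v.2 <;> simp
  · intro i hi
    by_cases hv : (f i).1 = v.1
    · have : (f i).2 ≠ v.2 := fun h => h2 i hi (Prod.ext hv h)
      simp only [litVal, x, hv, if_true]
      revert this
      cases (f i).2 <;> cases v.2 <;> cases c.val <;> simp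
    · simp only [litVal, x, hv, if_false]
      by_cases hb : (f i).2 = c.val
      · rw [decide_eq_true ⟨i, hi, Prod.ext rfl hb⟩, hb]
        cases c.val <;> rfl
      · rw [decide_eq_false]
        · revert hb
          cases (f i).2 <;> cases c.val <;> simp
        · rintro ⟨j, hj, hfj⟩
          refine h1 ⟨i, hi, j, hj, ?_⟩
          rw [hfj]
          refine Prod.ext rfl ?_
          revert hb
          simp only [sgn]
          cases (f i).2 <;> cases c.val <;> simp

section Literal

variable {c : Conn} {A B : Shape} {f : Pos A → ℕ × Bool} {g : Pos B → ℕ × Bool} {v : ℕ × Bool}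

/-- The leaves of a child of a `c`-node that belong to the scope of the node. -/
noncomputable def childScope (c : Conn) (s : Shape) : Finset (Pos s) :=
  altPat c.dual s ∪ childPat c s

theorem mem_pathSet_of_injOn (hf : ∀ i ∈ childScope c A, ∀ j ∈ childScope c A, i ≠ j →
    (f i).1 ≠ (f j).1) (hA : ∀ Q, Forces c.dual A Q → Opp f Q ∨ ∃ i ∈ Q, f i = v) :
    ∃ i ∈ pathSet c.dual A, f i = v := by
  have key : ∀ Q ⊆ altPat c.dual A, Forces c.dual A Q → ∃ i ∈ Q, f i = v := by
    intro Q hQ hF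
    rcases hA Q hF with ⟨i, hi, j, hj, h⟩ | h
    · refine absurd (congrArg Prod.fst h) (hf i (Finset.mem_union_left _ (hQ hi)) j
        (Finset.mem_union_left _ (hQ hj)) ?_)
      rintro rfl
      exact sgn_true_ne _ h
    · exact h
  obtain ⟨i, hi, hiv⟩ := key _ (pat_subset_altPat _ _) (forces_pat _ _)
  by_contra! hne
  obtain ⟨Q, hQ, hiQ, hF⟩ := exists_forces_of_notMem_pathSet (fun h => hne i h hiv)
  obtain ⟨j, hj, hjv⟩ := key Q hQ hF
  refine hf i (Finset.mem_union_left _ (pat_subset_altPat _ _ hi)) j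
    (Finset.mem_union_left _ (hQ hj)) ?_ (by rw [hiv, hjv])
  rintro rfl
  exact hiQ hj

theorem opp_pathSet_of_oneColl (hf : OneColl (childScope c A) f)
    (hg : ∀ i ∈ childScope c B, ∀ j ∈ childScope c B, i ≠ j → (g i).1 ≠ (g j).1)
    (hfg : ∀ i ∈ childScope c A, ∀ j ∈ childScope c B, (f i).1 ≠ (g j).1)
    (hA : ∀ Q, Forces c.dual A Q → Opp f Q ∨ ∃ i ∈ Q, f i = v)
    (hB : ∀ Q, Forces c.dual B Q → Opp g Q ∨ ∃ i ∈ Q, g i = v)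
    (hAB : ∀ P Q, Forces c A P → Forces c B Q → Opp f P ∨ Opp g Q ∨
      (∃ i ∈ P, ∃ j ∈ Q, (f i).1 = (g j).1) ∨ (∃ i ∈ P, f i = v) ∨ ∃ j ∈ Q, g j = v) :
    B = .leaf ∧ Opp f (pathSet c.dual A) := by
  obtain ⟨b, hb, hbv⟩ := mem_pathSet_of_injOn hg hB
  have hbS : b ∈ childScope c B := Finset.mem_union_left _ (pathSet_subset_altPat _ _ hb)
  have key : ∀ Q ⊆ altPat c.dual A, Forces c.dual A Q → Opp f Q := by
    intro Q hQ hF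
    rcases hA Q hF with h | ⟨i, hi, hiv⟩
    · exact h
    · exact absurd (by rw [hiv, hbv]) (hfg i (Finset.mem_union_left _ (hQ hi)) b hbS)
  have hS : ∀ {i}, i ∈ altPat c.dual A → i ∈ childScope c A := Finset.mem_union_left _
  obtain ⟨p, hp, q, hq, hpq⟩ := key _ (pat_subset_altPat _ _) (forces_pat _ _)
  replace hp := pat_subset_altPat _ _ hp
  replace hq := pat_subset_altPat _ _ hq
  have hne : ∀ {i j}, f i = sgn true (f j) → i ≠ j := by
    rintro i j h rfl
    exact sgn_true_ne _ h
  have huniq : ∀ i ∈ childScope c A, ∀ j ∈ childScope c A, f i = sgn true (f j) →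
      (i = p ∧ j = q) ∨ (i = q ∧ j = p) := fun i hi j hj h =>
    hf i hi j hj p (hS hp) q (hS hq) (hne h) (hne hpq) (fst_eq_of_eq_sgn h)
      (fst_eq_of_eq_sgn hpq)
  have hpp : p ∈ pathSet c.dual A := by
    by_contra hpn
    obtain ⟨Q, hQ, hpQ, hF⟩ := exists_forces_of_notMem_pathSet hpn
    obtain ⟨i, hi, j, hj, hij⟩ := key Q hQ hF
    rcases huniq i (hS (hQ hi)) j (hS (hQ hj)) hij with ⟨rfl, -⟩ | ⟨-, rfl⟩
    · exact hpQ hi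
    · exact hpQ hj
  have hqp : q ∈ pathSet c.dual A := by
    by_contra hqn
    obtain ⟨Q, hQ, hqQ, hF⟩ := exists_forces_of_notMem_pathSet hqn
    obtain ⟨i, hi, j, hj, hij⟩ := key Q hQ hF
    rcases huniq i (hS (hQ hi)) j (hS (hQ hj)) hij with ⟨-, rfl⟩ | ⟨rfl, -⟩
    · exact hqQ hj
    · exact hqQ hi
  refine ⟨?_, p, hpp, q, hqp, hpq⟩
  by_contra hBl
  obtain ⟨Q, hQ, hbQ, hF⟩ := exists_forces_of_mem_pathSet_dual hBl hb
  have hSA : ∀ {i}, i ∈ pat c A → i ∈ childScope c A := fun h =>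
    Finset.mem_union_right _ (pat_subset_childPat _ _ h)
  have hSB : ∀ {i}, i ∈ Q → i ∈ childScope c B := fun h => Finset.mem_union_right _ (hQ h)
  rcases hAB _ _ (forces_pat c A) hF with ⟨i, hi, j, hj, h⟩ | ⟨i, hi, j, hj, h⟩ |
    ⟨i, hi, j, hj, h⟩ | ⟨i, hi, h⟩ | ⟨j, hj, h⟩
  · rcases huniq i (hSA hi) j (hSA hj) h with ⟨rfl, rfl⟩ | ⟨rfl, rfl⟩
    · exact hne h (eq_of_mem_pat_of_mem_pathSet_dual hpp hqp hi hj)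
    · exact hne h (eq_of_mem_pat_of_mem_pathSet_dual hqp hpp hi hj)
  · refine hg i (hSB hi) j (hSB hj) ?_ (fst_eq_of_eq_sgn h)
    rintro rfl
    exact sgn_true_ne _ h
  · exact hfg i (hSA hi) j (hSB hj) h
  · exact hfg i (hSA hi) b hbS (by rw [h, hbv])
  · refine hg j (hSB hj) b hbS ?_ (by rw [h, hbv])
    rintro rfl
    exact hbQ hj

theorem leaf_or_leaf_of_injOn
    (hf : ∀ i ∈ childScope c A, ∀ j ∈ childScope c A, i ≠ j → (f i).1 ≠ (f j).1)
    (hg : ∀ i ∈ childScope c B, ∀ j ∈ childScope c B, i ≠ j → (g i).1 ≠ (g j).1)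
    (hfg : ∀ i ∈ childScope c A, ∀ j ∈ childScope c B, ∀ i' ∈ childScope c A,
      ∀ j' ∈ childScope c B, (f i).1 = (g j).1 → (f i').1 = (g j').1 → i = i')
    (hA : ∀ Q, Forces c.dual A Q → Opp f Q ∨ ∃ i ∈ Q, f i = v)
    (hB : ∀ Q, Forces c.dual B Q → Opp g Q ∨ ∃ i ∈ Q, g i = v)
    (hAB : ∀ P Q, Forces c A P → Forces c B Q → Opp f P ∨ Opp g Q ∨
      (∃ i ∈ P, ∃ j ∈ Q, (f i).1 = (g j).1) ∨ (∃ i ∈ P, f i = v) ∨ ∃ j ∈ Q, g j = v) :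
    (A = .leaf ∨ B = .leaf) ∧ ∃ i ∈ pathSet c.dual A, ∃ j ∈ pathSet c.dual B, f i = g j := by
  obtain ⟨a, ha, hav⟩ := mem_pathSet_of_injOn hf hA
  obtain ⟨b, hb, hbv⟩ := mem_pathSet_of_injOn hg hB
  have haS : a ∈ childScope c A := Finset.mem_union_left _ (pathSet_subset_altPat _ _ ha)
  have hbS : b ∈ childScope c B := Finset.mem_union_left _ (pathSet_subset_altPat _ _ hb)
  refine ⟨?_, a, ha, b, hb, by rw [hav, hbv]⟩
  by_contra! hl
  obtain ⟨P, hP, haP, hFP⟩ := exists_forces_of_mem_pathSet_dual hl.1 ha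
  obtain ⟨Q, hQ, hbQ, hFQ⟩ := exists_forces_of_mem_pathSet_dual hl.2 hb
  have hSA : ∀ {i}, i ∈ P → i ∈ childScope c A := fun h => Finset.mem_union_right _ (hP h)
  have hSB : ∀ {i}, i ∈ Q → i ∈ childScope c B := fun h => Finset.mem_union_right _ (hQ h)
  rcases hAB _ _ hFP hFQ with ⟨i, hi, j, hj, h⟩ | ⟨i, hi, j, hj, h⟩ |
    ⟨i, hi, j, hj, h⟩ | ⟨i, hi, h⟩ | ⟨j, hj, h⟩
  · refine hf i (hSA hi) j (hSA hj) ?_ (fst_eq_of_eq_sgn h)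
    rintro rfl
    exact sgn_true_ne _ h
  · refine hg i (hSB hi) j (hSB hj) ?_ (fst_eq_of_eq_sgn h)
    rintro rfl
    exact sgn_true_ne _ h
  · obtain rfl := hfg i (hSA hi) j (hSB hj) a haS b hbS h (by rw [hav, hbv])
    exact haP hi
  · refine hf i (hSA hi) a haS ?_ (by rw [h, hav])
    rintro rfl
    exact haP hi
  · refine hg j (hSB hj) b hbS ?_ (by rw [h, hbv])
    rintro rfl
    exact hbQ hj

end Literal

/-- A leaf with the given literal linked to the root by `c`-labelled internal nodes only. -/
def pathLeaf : Conn → AOTree → ℕ × Bool → Prop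
  | .and => andLeaf
  | .or => orLeaf

theorem pathLeaf_ofShape (c : Conn) (s : Shape) (f : Pos s → ℕ × Bool) (v : ℕ × Bool) :
    pathLeaf c (ofShape s f) v ↔ ∃ i ∈ pathSet c s, f i = v := by
  induction s with
  | leaf =>
    have : pathLeaf c (ofShape .leaf f) v ↔ f .here = v := by cases c <;> rfl
    rw [this]
    constructor
    · exact fun h => ⟨.here, Finset.mem_univ _, h⟩
    · rintro ⟨i, -, h⟩
      cases i
      exact h
  | node d l r ihl ihr =>
    by_cases hd : d = c
    · subst hd
      have : pathLeaf d (ofShape (.node d l r) f) v ↔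
          pathLeaf d (ofShape l fun i => f (.inl i)) v ∨
          pathLeaf d (ofShape r fun i => f (.inr i)) v := by cases d <;> rfl
      rw [this, ihl, ihr]
      constructor
      · rintro (⟨i, hi, h⟩ | ⟨i, hi, h⟩)
        · exact ⟨.inl i, by simpa [pathSet] using hi, h⟩
        · exact ⟨.inr i, by simpa [pathSet] using hi, h⟩
      · rintro ⟨_ | i | i, hi, h⟩
        · exact Or.inl ⟨i, by simpa [pathSet] using hi, h⟩
        · exact Or.inr ⟨i, by simpa [pathSet] using hi, h⟩
    · have : pathLeaf c (ofShape (.node d l r) f) v ↔ False := by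
        cases c <;> cases d <;> first | exact absurd rfl hd | rfl
      rw [this, false_iff]
      rintro ⟨i, hi, -⟩
      simp [pathSet, hd] at hi

/-- Simple-x trees (of type T or X). -/
def IsSimpleX (t : AOTree) : Prop := IsSimpleXT t ∨ IsSimpleXX t

theorem isSimpleX_iff (t : AOTree) : IsSimpleX t ↔ ∃ (c : Conn) (v : ℕ × Bool) (s : AOTree),
    (t = .node c (.leaf v.1 v.2) s ∨ t = .node c s (.leaf v.1 v.2)) ∧
    ((∃ w b, pathLeaf c.dual s (w, b) ∧ pathLeaf c.dual s (w, !b)) ∨ pathLeaf c.dual s v) := by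
  constructor
  · rintro ((⟨v, b, s, h, hs⟩ | ⟨v, b, s, h, hs⟩) | (⟨v, b, s, h, hs⟩ | ⟨v, b, s, h, hs⟩))
    · exact ⟨.and, (v, b), s, h, Or.inl hs⟩
    · exact ⟨.or, (v, b), s, h, Or.inl hs⟩
    · exact ⟨.and, (v, b), s, h, Or.inr hs⟩
    · exact ⟨.or, (v, b), s, h, Or.inr hs⟩
  · rintro ⟨c, ⟨v, b⟩, s, h, hs | hs⟩ <;> cases c
    · exact Or.inl (Or.inl ⟨v, b, s, h, hs⟩)
    · exact Or.inl (Or.inr ⟨v, b, s, h, hs⟩)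
    · exact Or.inr (Or.inl ⟨v, b, s, h, hs⟩)
    · exact Or.inr (Or.inr ⟨v, b, s, h, hs⟩)

theorem opp_pathSet_iff (c : Conn) (s : Shape) (f : Pos s → ℕ × Bool) :
    Opp f (pathSet c s) ↔
      ∃ w b, pathLeaf c (ofShape s f) (w, b) ∧ pathLeaf c (ofShape s f) (w, !b) := by
  simp only [pathLeaf_ofShape]
  constructor
  · rintro ⟨i, hi, j, hj, h⟩
    exact ⟨(f j).1, (f j).2, ⟨j, hj, rfl⟩, i, hi, by rw [h]; simp [sgn]⟩
  · rintro ⟨w, b, ⟨j, hj, h⟩, i, hi, h'⟩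
    exact ⟨i, hi, j, hj, by rw [h, h']; simp [sgn]⟩

/-- The leaf `o` absorbs a child whose `c.dual`-path leaves are `Λ` when it is expanded
in the simplest way. -/
theorem expands_left_iff (c : Conn) (A : Shape) (f : Pos (.node c .leaf A) → ℕ × Bool) :
    Expands (.inl .here) (Pos.join ∅ (pathSet c.dual A)) f ↔
      Opp (fun i => f (.inr i)) (pathSet c.dual A) ∨
        ∃ i ∈ pathSet c.dual A, f (.inr i) = f (.inl .here) := by
  constructor
  · rintro (⟨_ | i | i, hi, _ | j | j, hj, h⟩ | ⟨_ | i | i, hi, h⟩)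
    all_goals simp at *
    · exact Or.inl ⟨i, hi, j, hj, h⟩
    · exact Or.inr ⟨i, hi, h⟩
  · rintro (⟨i, hi, j, hj, h⟩ | ⟨i, hi, h⟩)
    · exact Or.inl ⟨.inr i, by simpa, .inr j, by simpa, h⟩
    · exact Or.inr ⟨.inr i, by simpa, h⟩

theorem expands_right_iff (c : Conn) (A : Shape) (f : Pos (.node c A .leaf) → ℕ × Bool) :
    Expands (.inr .here) (Pos.join (pathSet c.dual A) ∅) f ↔
      Opp (fun i => f (.inl i)) (pathSet c.dual A) ∨
        ∃ i ∈ pathSet c.dual A, f (.inl i) = f (.inr .here) := by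
  constructor
  · rintro (⟨_ | i | i, hi, _ | j | j, hj, h⟩ | ⟨_ | i | i, hi, h⟩)
    all_goals simp at *
    · exact Or.inl ⟨i, hi, j, hj, h⟩
    · exact Or.inr ⟨i, hi, h⟩
  · rintro (⟨i, hi, j, hj, h⟩ | ⟨i, hi, h⟩)
    · exact Or.inl ⟨.inl i, by simpa, .inl j, by simpa, h⟩
    · exact Or.inr ⟨.inl i, by simpa, h⟩

theorem ofShape_eq_leaf {s : Shape} {f : Pos s → ℕ × Bool} {v : ℕ} {b : Bool}
    (h : ofShape s f = .leaf v b) : s = .leaf := by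
  cases s with
  | leaf => rfl
  | node c l r => cases h

theorem isSimpleX_left {c : Conn} {A : Shape} (hA : A ≠ .leaf)
    (f : Pos (.node c .leaf A) → ℕ × Bool) :
    IsSimpleX (ofShape (.node c .leaf A) f) ↔
      Expands (.inl .here) (Pos.join ∅ (pathSet c.dual A)) f := by
  rw [expands_left_iff, isSimpleX_iff, opp_pathSet_iff, ← pathLeaf_ofShape]
  constructor
  · rintro ⟨d, v, s, h | h, hs⟩
    · simp only [ofShape, AOTree.node.injEq, AOTree.leaf.injEq] at h
      obtain ⟨rfl, ⟨h1, h2⟩, rfl⟩ := h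
      obtain rfl : f (.inl .here) = v := Prod.ext h1 h2
      exact hs
    · simp only [ofShape, AOTree.node.injEq] at h
      exact absurd (ofShape_eq_leaf h.2.2) hA
  · exact fun h => ⟨c, f (.inl .here), _, Or.inl rfl, h⟩

theorem isSimpleX_right {c : Conn} {A : Shape} (hA : A ≠ .leaf)
    (f : Pos (.node c A .leaf) → ℕ × Bool) :
    IsSimpleX (ofShape (.node c A .leaf) f) ↔
      Expands (.inr .here) (Pos.join (pathSet c.dual A) ∅) f := by
  rw [expands_right_iff, isSimpleX_iff, opp_pathSet_iff, ← pathLeaf_ofShape]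
  constructor
  · rintro ⟨d, v, s, h | h, hs⟩
    · simp only [ofShape, AOTree.node.injEq] at h
      exact absurd (ofShape_eq_leaf h.2.1) hA
    · simp only [ofShape, AOTree.node.injEq, AOTree.leaf.injEq] at h
      obtain ⟨rfl, rfl, h1, h2⟩ := h
      obtain rfl : f (.inr .here) = v := Prod.ext h1 h2
      exact hs
  · exact fun h => ⟨c, f (.inr .here), _, Or.inr rfl, h⟩

theorem not_isSimpleX {c : Conn} {A B : Shape} (hA : A ≠ .leaf) (hB : B ≠ .leaf)
    (f : Pos (.node c A B) → ℕ × Bool) : ¬ IsSimpleX (ofShape (.node c A B) f) := by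
  rw [isSimpleX_iff]
  rintro ⟨d, v, s, h | h, hs⟩
  · simp only [ofShape, AOTree.node.injEq] at h
    exact hA (ofShape_eq_leaf h.2.1)
  · simp only [ofShape, AOTree.node.injEq] at h
    exact hB (ofShape_eq_leaf h.2.2)

/-- The tree computes a literal. -/
def ComputesLit (t : AOTree) : Prop := ∃ v : ℕ × Bool, ∀ x, t.eval x = litVal v x

theorem eval_node (c : Conn) (A B : AOTree) (x : ℕ → Bool) :
    (AOTree.node c A B).eval x = c.op (A.eval x) (B.eval x) := by
  cases c <;> rfl

theorem eval_leaf (v : ℕ × Bool) (x : ℕ → Bool) : (AOTree.leaf v.1 v.2).eval x = litVal v x := by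
  simp only [AOTree.eval, litVal]
  cases v.2 <;> simp

theorem eval_of_pathLeaf {c : Conn} {t : AOTree} {v : ℕ × Bool} (h : pathLeaf c t v)
    {x : ℕ → Bool} (hx : litVal v x = !c.val) : t.eval x = !c.val := by
  induction t with
  | leaf w b =>
    have hv : (w, b) = v := by cases c <;> exact h
    rw [← hx, ← hv]
    simp only [AOTree.eval, litVal]
    cases b <;> simp
  | node d l r ihl ihr =>
    rw [eval_node]
    cases c <;> cases d
    · rcases h with h | h
      · rw [ihl h]; rfl
      · rw [ihr h]; cases l.eval x <;> rfl
    · exact h.elim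
    · exact h.elim
    · rcases h with h | h
      · rw [ihl h]; rfl
      · rw [ihr h]; cases l.eval x <;> rfl

theorem IsSimpleX.computesLit {t : AOTree} (h : IsSimpleX t) : ComputesLit t := by
  obtain ⟨c, v, s, ht, hs⟩ := (isSimpleX_iff t).1 h
  have key : ∀ x, litVal v x = c.val → s.eval x = c.val := by
    intro x hx
    rcases hs with ⟨w, b, h1, h2⟩ | h1
    · rw [← Bool.not_not c.val, ← Conn.val_dual]
      by_cases hw : litVal (w, b) x = !c.dual.val
      · exact eval_of_pathLeaf h1 hw
      · refine eval_of_pathLeaf h2 ?_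
        revert hw
        simp only [litVal]
        cases x w <;> cases b <;> cases c.dual.val <;> simp
    · rw [← Bool.not_not c.val, ← Conn.val_dual]
      exact eval_of_pathLeaf h1 (by rw [hx, Conn.val_dual, Bool.not_not])
  refine ⟨v, fun x => ?_⟩
  have hk := key x
  rcases ht with rfl | rfl <;> rw [eval_node, eval_leaf] <;> revert hk <;>
    cases litVal v x <;> cases s.eval x <;> cases c <;> simp [Conn.val, Conn.op]

theorem isSimpleX_of_computesLit {c : Conn} {A B : Shape} {f : Pos (.node c A B) → ℕ × Bool}
    (hf : OneColl (scope (.node c A B)) f) (h : ComputesLit (ofShape (.node c A B) f)) :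
    IsSimpleX (ofShape (.node c A B) f) := by
  obtain ⟨v, hv⟩ := h
  have hev : ∀ x, (Shape.node c A B).ev (fun i => litVal (f i) x) = litVal v x := fun x => by
    rw [← eval_ofShape, hv]
  have hl : ∀ {i}, i ∈ childScope c A → (.inl i : Pos (.node c A B)) ∈ scope (.node c A B) :=
    fun h => Pos.inl_mem_join.2 h
  have hr : ∀ {i}, i ∈ childScope c B → (.inr i : Pos (.node c A B)) ∈ scope (.node c A B) :=
    fun h => Pos.inr_mem_join.2 h
  have hA : ∀ Q, Forces c.dual A Q →
      Opp (fun i => f (.inl i)) Q ∨ ∃ i ∈ Q, f (.inl i) = v := by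
    intro Q hQ
    rcases opp_or_mem_of_forces hev (hQ.left c (Conn.dual_ne c).symm ∅) with
      ⟨_ | i | i, hi, _ | j | j, hj, h⟩ | ⟨_ | i | i, hi, h⟩
    all_goals simp at hi
    all_goals try simp at hj
    · exact Or.inl ⟨i, hi, j, hj, h⟩
    · exact Or.inr ⟨i, hi, h⟩
  have hB : ∀ Q, Forces c.dual B Q →
      Opp (fun i => f (.inr i)) Q ∨ ∃ i ∈ Q, f (.inr i) = v := by
    intro Q hQ
    rcases opp_or_mem_of_forces hev (hQ.right c (Conn.dual_ne c).symm ∅) with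
      ⟨_ | i | i, hi, _ | j | j, hj, h⟩ | ⟨_ | i | i, hi, h⟩
    all_goals simp at hi
    all_goals try simp at hj
    · exact Or.inl ⟨i, hi, j, hj, h⟩
    · exact Or.inr ⟨i, hi, h⟩
  have hAB : ∀ P Q, Forces c A P → Forces c B Q → Opp (fun i => f (.inl i)) P ∨
      Opp (fun i => f (.inr i)) Q ∨ (∃ i ∈ P, ∃ j ∈ Q, (f (.inl i)).1 = (f (.inr j)).1) ∨
      (∃ i ∈ P, f (.inl i) = v) ∨ ∃ j ∈ Q, f (.inr j) = v := by
    intro P Q hP hQ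
    rcases opp_or_mem_of_forces hev (hP.join hQ) with
      ⟨_ | i | i, hi, _ | j | j, hj, h⟩ | ⟨_ | i | i, hi, h⟩
    all_goals simp at hi
    all_goals try simp at hj
    · exact Or.inl ⟨i, hi, j, hj, h⟩
    · exact Or.inr (Or.inr (Or.inl ⟨i, hi, j, hj, fst_eq_of_eq_sgn h⟩))
    · exact Or.inr (Or.inr (Or.inl ⟨j, hj, i, hi, (fst_eq_of_eq_sgn h).symm⟩))
    · exact Or.inr (Or.inl ⟨i, hi, j, hj, h⟩)
    · exact Or.inr (Or.inr (Or.inr (Or.inl ⟨i, hi, h⟩)))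
    · exact Or.inr (Or.inr (Or.inr (Or.inr ⟨i, hi, h⟩)))
  have hBA : ∀ Q P, Forces c B Q → Forces c A P → Opp (fun i => f (.inr i)) Q ∨
      Opp (fun i => f (.inl i)) P ∨ (∃ j ∈ Q, ∃ i ∈ P, (f (.inr j)).1 = (f (.inl i)).1) ∨
      (∃ j ∈ Q, f (.inr j) = v) ∨ ∃ i ∈ P, f (.inl i) = v := by
    intro Q P hQ hP
    rcases hAB P Q hP hQ with h | h | ⟨i, hi, j, hj, h⟩ | h | h
    · exact Or.inr (Or.inl h)
    · exact Or.inl h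
    · exact Or.inr (Or.inr (Or.inl ⟨j, hj, i, hi, h.symm⟩))
    · exact Or.inr (Or.inr (Or.inr (Or.inr h)))
    · exact Or.inr (Or.inr (Or.inr (Or.inl h)))
  have hinl : OneColl (childScope c A) fun i => f (.inl i) := by
    intro a ha b hb a' ha' b' hb' hab hab' h h'
    simpa using hf _ (hl ha) _ (hl hb) _ (hl ha') _ (hl hb') (by simpa) (by simpa) h h'
  have hinr : OneColl (childScope c B) fun i => f (.inr i) := by
    intro a ha b hb a' ha' b' hb' hab hab' h h'
    simpa using hf _ (hr ha) _ (hr hb) _ (hr ha') _ (hr hb') (by simpa) (by simpa) h h'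
  have hcross : ∀ i ∈ childScope c A, ∀ j ∈ childScope c B, ∀ i' ∈ childScope c A,
      ∀ j' ∈ childScope c B, (f (.inl i)).1 = (f (.inr j)).1 →
      (f (.inl i')).1 = (f (.inr j')).1 → i = i' := by
    intro i hi j hj i' hi' j' hj' h h'
    have := hf _ (hl hi) _ (hr hj) _ (hl hi') _ (hr hj') (by simp) (by simp) h h'
    simp only [Pos.inl.injEq, reduceCtorEq, false_and, or_false] at this
    exact this.1
  by_cases h1 : ∃ i ∈ childScope c A, ∃ j ∈ childScope c A, i ≠ j ∧ (f (.inl i)).1 = (f (.inl j)).1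
  · obtain ⟨i, hi, j, hj, hij, h⟩ := h1
    obtain ⟨rfl, ho⟩ := opp_pathSet_of_oneColl (g := fun i => f (.inr i)) hinl
      (fun i' hi' j' hj' hij' h' => by
        simpa using hf _ (hl hi) _ (hl hj) _ (hr hi') _ (hr hj') (by simpa) (by simpa) h h')
      (fun i' hi' j' hj' h' => by
        simpa using hf _ (hl hi) _ (hl hj) _ (hl hi') _ (hr hj') (by simpa) (by simp) h h')
      hA hB hAB
    rw [isSimpleX_iff]
    exact ⟨c, f (.inr .here), _, Or.inr rfl, Or.inl ((opp_pathSet_iff _ _ _).1 ho)⟩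
  · by_cases h2 : ∃ i ∈ childScope c B, ∃ j ∈ childScope c B, i ≠ j ∧
        (f (.inr i)).1 = (f (.inr j)).1
    · obtain ⟨i, hi, j, hj, hij, h⟩ := h2
      obtain ⟨rfl, ho⟩ := opp_pathSet_of_oneColl (g := fun i => f (.inl i)) hinr
        (fun i' hi' j' hj' hij' h' => by
          simpa using hf _ (hr hi) _ (hr hj) _ (hl hi') _ (hl hj') (by simpa) (by simpa) h h')
        (fun i' hi' j' hj' h' => by
          simpa using hf _ (hr hi) _ (hr hj) _ (hr hi') _ (hl hj') (by simpa) (by simp) h h')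
        hB hA hBA
      rw [isSimpleX_iff]
      exact ⟨c, f (.inl .here), _, Or.inl rfl, Or.inl ((opp_pathSet_iff _ _ _).1 ho)⟩
    · push Not at h1 h2
      obtain ⟨rfl | rfl, i, hi, j, hj, h⟩ := leaf_or_leaf_of_injOn h1 h2 hcross hA hB hAB
      · rw [isSimpleX_iff]
        cases i
        exact ⟨c, f (.inl .here), _, Or.inl rfl,
          Or.inr ((pathLeaf_ofShape _ _ _ _).2 ⟨j, hj, h.symm⟩)⟩
      · rw [isSimpleX_iff]
        cases j
        exact ⟨c, f (.inr .here), _, Or.inr rfl,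
          Or.inr ((pathLeaf_ofShape _ _ _ _).2 ⟨i, hi, h⟩)⟩

theorem funEquiv_proj_iff (t : AOTree) : FunEquiv t.eval (fun x => x 1) ↔ ComputesLit t := by
  classical
  constructor
  · rintro ⟨A, B, hAB, hA, hB⟩
    obtain ⟨s, f, rfl⟩ : ∃ s f, ofShape s f = A := ⟨_, _, ofShape_toShape A⟩
    obtain ⟨s', g, rfl⟩ : ∃ s f, ofShape s f = B := ⟨_, _, ofShape_toShape B⟩
    have hs : s = s' := by rw [← shape_ofShape s f, hAB.1, shape_ofShape]
    subst hs
    have hker := ker_eq_iff.1 ((treeEquiv_ofShape f g).1 hAB)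
    have h1 : ∃ i, (g i).1 = 1 := by
      by_contra! hne
      have h := congrFun hB fun _ => false
      have h' := congrFun hB fun w => decide (w = 1)
      have : ∀ i, litVal (g i) (fun _ => false) = litVal (g i) fun w => decide (w = 1) := by
        intro i
        simp [litVal, hne i]
      rw [eval_ofShape] at h h'
      simp only [this] at h
      rw [h] at h'
      simp at h'
    let y : (ℕ → Bool) → ℕ → Bool := fun x w =>
      if h : ∃ i, (g i).1 = w then litVal (f h.choose) x == (g h.choose).2 else false
    have hy : ∀ x j, litVal (g j) (y x) = litVal (f j) x := by
      intro x j
      have hj : ∃ i, (g i).1 = (g j).1 := ⟨j, rfl⟩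
      have hc := hj.choose_spec
      have hk := hker hj.choose j
      have hfc := hk.1.2 hc
      have h2 : (f hj.choose).2 = (f j).2 ↔ (g hj.choose).2 = (g j).2 := by
        have := hk.2
        simpa only [Prod.ext_iff, hc, hfc, true_and] using this
      simp only [litVal, y, dif_pos hj, hfc]
      revert h2
      cases x (f j).1 <;> cases (f hj.choose).2 <;> cases (f j).2 <;> cases (g hj.choose).2 <;>
        cases (g j).2 <;> simp
    refine ⟨((f h1.choose).1, (f h1.choose).2 == (g h1.choose).2), fun x => ?_⟩
    have h := congrFun hB (y x)
    rw [eval_ofShape] at h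
    simp only [hy] at h
    rw [← congrFun hA x, eval_ofShape, h]
    simp only [y, dif_pos h1, litVal]
    cases x (f h1.choose).1 <;> cases (f h1.choose).2 <;> cases (g h1.choose).2 <;> rfl
  · rintro ⟨v, hv⟩
    refine ⟨.leaf v.1 v.2, .leaf 1 true, ⟨rfl, fun i j hi hj => ?_⟩,
      funext fun x => by rw [eval_leaf, hv], funext fun x => by simp [AOTree.eval]⟩
    simp only [AOTree.leaves, List.length_singleton, Nat.lt_one_iff] at hi hj
    subst hi
    subst hj
    simp

/-- The number of tree-structures with `n` leaves. -/
noncomputable def shapeCount (n : ℕ) : ℕ := (shapes n).card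

theorem shapeCount_zero : shapeCount 0 = 0 := by simp [shapeCount, shapes_zero]

theorem shapeCount_one : shapeCount 1 = 1 := by simp [shapeCount, shapes_one]

theorem shapeCount_add_two (n : ℕ) : shapeCount (n + 2) =
    2 * ∑ p ∈ antidiagonal (n + 2), shapeCount p.1 * shapeCount p.2 := by
  have := sum_shapes (M := ℕ) n fun _ => 1
  simp only [Finset.sum_const, smul_eq_mul, mul_one] at this
  rw [shapeCount, this, Finset.mul_sum]
  exact Finset.sum_congr rfl fun p _ => by rw [shapeCount, shapeCount]; ring

theorem shapeCount_succ (n : ℕ) : shapeCount (n + 1) = 2 ^ n * catalan n := by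
  induction n using Nat.strong_induction_on with
  | _ n ih =>
    rcases n with _ | n
    · simp [shapeCount_one]
    · rw [shapeCount_add_two, Finset.Nat.sum_antidiagonal_succ, Finset.Nat.sum_antidiagonal_succ',
        shapeCount_zero, catalan_succ', Finset.mul_sum, zero_mul, mul_zero, zero_add, zero_add,
        Finset.mul_sum]
      refine Finset.sum_congr rfl fun p hp => ?_
      have hp' := mem_antidiagonal.1 hp
      rw [ih p.1 (by omega), ih p.2 (by omega), ← hp']
      ring

theorem shapeCount_rec (n : ℕ) :
    (n + 2) * shapeCount (n + 2) = 4 * (2 * n + 1) * shapeCount (n + 1) := by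
  rw [shapeCount_succ, shapeCount_succ]
  have h1 := succ_mul_catalan_eq_centralBinom (n + 1)
  have h2 := succ_mul_catalan_eq_centralBinom n
  have h3 := Nat.succ_mul_centralBinom_succ n
  have : (n + 1) * ((n + 2) * catalan (n + 1)) = (n + 1) * (2 * (2 * n + 1) * catalan n) := by
    rw [h1, h3, ← h2]
    ring
  have := Nat.eq_of_mul_eq_mul_left n.succ_pos this
  calc _ = 2 ^ (n + 1) * ((n + 2) * catalan (n + 1)) := by ring
    _ = _ := by rw [this]; ring

theorem shapeCount_le_succ (n : ℕ) : shapeCount n ≤ shapeCount (n + 1) := by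
  rcases n with _ | n
  · simp [shapeCount_zero]
  · refine Nat.le_of_mul_le_mul_left (c := n + 2) ?_ (by omega)
    rw [shapeCount_rec]
    exact Nat.mul_le_mul_right _ (by omega)

theorem shapeCount_succ_le (n : ℕ) : shapeCount (n + 2) ≤ 8 * shapeCount (n + 1) := by
  refine Nat.le_of_mul_le_mul_left (c := n + 2) ?_ (by omega)
  rw [shapeCount_rec, ← mul_assoc]
  exact Nat.mul_le_mul_right _ (by omega)

theorem shapeCount_pos (n : ℕ) : 0 < shapeCount (n + 1) := by
  induction n with
  | zero => simp [shapeCount_one]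
  | succ n ih => exact ih.trans_le (shapeCount_le_succ _)

theorem tendsto_shapeCount_div :
    Tendsto (fun n => (shapeCount n : ℝ) / shapeCount (n + 1)) atTop (nhds (1 / 8)) := by
  rw [← tendsto_add_atTop_iff_nat 1]
  have h : ∀ n : ℕ, (shapeCount (n + 1) : ℝ) / shapeCount (n + 1 + 1) =
      1 / 8 + (3 / 8) * (1 / (2 * n + 1)) := by
    intro n
    have h1 : (0 : ℝ) < shapeCount (n + 2) := by exact_mod_cast shapeCount_pos (n + 1)
    have h2 : ((n : ℝ) + 2) * shapeCount (n + 2) = 4 * (2 * n + 1) * shapeCount (n + 1) := by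
      exact_mod_cast shapeCount_rec n
    rw [div_eq_iff h1.ne']
    field_simp
    linarith
  simp_rw [h]
  have : Tendsto (fun n : ℕ => 1 / (2 * (n : ℝ) + 1)) atTop (nhds 0) :=
    tendsto_const_nhds.div_atTop (tendsto_atTop_add_const_right _ _
      (tendsto_natCast_atTop_atTop.const_mul_atTop two_pos))
  have h0 := (this.const_mul (3 / 8)).const_add (1 / 8)
  rwa [mul_zero, add_zero] at h0

theorem card_pathSet_node (c d : Conn) (l r : Shape) : (pathSet c (.node d l r)).card =
    if d = c then (pathSet c l).card + (pathSet c r).card else 0 := by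
  rw [pathSet]
  split_ifs <;> simp [Pos.card_join]

theorem sum_shapes_of_dual {M : Type*} [AddCommMonoid M] (c : Conn) (n : ℕ) (g : Shape → M) :
    ∑ s ∈ shapes (n + 2), g s = ∑ p ∈ antidiagonal (n + 2), ∑ l ∈ shapes p.1,
      ∑ r ∈ shapes p.2, (g (.node c l r) + g (.node c.dual l r)) := by
  rw [sum_shapes]
  cases c
  · rfl
  · simp_rw [add_comm (g (.node .and _ _))]
    rfl

theorem sum_card_pathSet (c : Conn) (n : ℕ) :
    ∑ s ∈ shapes n, (pathSet c s).card = shapeCount n := by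
  induction n using Nat.strong_induction_on with
  | _ n ih =>
    rcases n with _ | _ | n
    · simp [shapes_zero, shapeCount_zero]
    · rw [shapes_one, Finset.sum_singleton, shapeCount_one]
      rfl
    · rw [sum_shapes_of_dual c, shapeCount_add_two, Finset.mul_sum]
      refine Finset.sum_congr rfl fun p hp => ?_
      have hp' := mem_antidiagonal.1 hp
      simp only [card_pathSet_node, if_true, Conn.dual_ne, if_false, add_zero,
        Finset.sum_add_distrib, Finset.sum_const, smul_eq_mul, ← Finset.mul_sum]
      rw [← shapeCount, ← shapeCount]
      rcases Nat.eq_zero_or_pos p.1 with h1 | h1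
      · simp [h1, shapes_zero, shapeCount_zero]
      rcases Nat.eq_zero_or_pos p.2 with h2 | h2
      · simp [h2, shapes_zero, shapeCount_zero]
      rw [ih p.1 (by omega), ih p.2 (by omega)]
      ring

theorem sum_card_pathSet_sq (c : Conn) (n : ℕ) :
    2 * ∑ s ∈ shapes (n + 1), (pathSet c s).card ^ 2 = shapeCount (n + 2) := by
  induction n using Nat.strong_induction_on with
  | _ n ih =>
    rcases n with _ | n
    · rw [shapes_one, Finset.sum_singleton, shapeCount_succ, catalan_one]
      rfl
    · have h1 : ∑ s ∈ shapes (n + 2), (pathSet c s).card ^ 2 =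
          ∑ p ∈ antidiagonal (n + 2), ((∑ s ∈ shapes p.1, (pathSet c s).card ^ 2) * shapeCount p.2 +
            (∑ s ∈ shapes p.2, (pathSet c s).card ^ 2) * shapeCount p.1 +
            2 * (shapeCount p.1 * shapeCount p.2)) := by
        rw [sum_shapes_of_dual c]
        refine Finset.sum_congr rfl fun p _ => ?_
        simp only [card_pathSet_node, if_true, Conn.dual_ne, if_false, add_sq, zero_pow two_ne_zero,
          add_zero, Finset.sum_add_distrib, Finset.sum_const, smul_eq_mul, ← Finset.mul_sum,
          ← Finset.sum_mul, sum_card_pathSet]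
        rw [← shapeCount, ← shapeCount]
        ring
      have hsw : ∑ p ∈ antidiagonal (n + 2),
          (∑ s ∈ shapes p.2, (pathSet c s).card ^ 2) * shapeCount p.1 =
          ∑ p ∈ antidiagonal (n + 2), (∑ s ∈ shapes p.1, (pathSet c s).card ^ 2) * shapeCount p.2 :=
        Finset.Nat.sum_antidiagonal_swap
          (f := fun p => (∑ s ∈ shapes p.1, (pathSet c s).card ^ 2) * shapeCount p.2)
      rw [h1, Finset.sum_add_distrib, Finset.sum_add_distrib, hsw, ← Finset.mul_sum,
        ← shapeCount_add_two, shapeCount_add_two (n + 1), Finset.Nat.sum_antidiagonal_succ,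
        Finset.Nat.sum_antidiagonal_succ (n := n + 2),
        Finset.Nat.sum_antidiagonal_succ (n := n + 1)]
      simp only [shapes_zero, Finset.sum_empty, zero_mul, zero_add, shapeCount_one, one_mul,
        shapeCount_zero]
      have : ∀ p ∈ antidiagonal (n + 1),
          2 * ((∑ s ∈ shapes (p.1 + 1), (pathSet c s).card ^ 2) * shapeCount p.2) =
          shapeCount (p.1 + 1 + 1) * shapeCount p.2 := by
        intro p hp
        have hp' := mem_antidiagonal.1 hp
        rcases Nat.eq_zero_or_pos p.2 with h2 | h2
        · simp [h2, shapeCount_zero]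
        rw [← mul_assoc, ih p.1 (by omega)]
      rw [← Finset.sum_congr rfl this, ← Finset.mul_sum]
      ring

theorem sum_shapeCount_mul_le (n : ℕ) :
    ∑ p ∈ antidiagonal n, (shapeCount p.1 : ℝ) * shapeCount p.2 ≤ shapeCount n / 2 := by
  rcases n with _ | _ | n
  · simp [shapeCount_zero]
  · simp [Finset.Nat.antidiagonal_succ, shapeCount_zero, shapeCount_one]
  · have : (shapeCount (n + 2) : ℝ) =
        2 * ∑ p ∈ antidiagonal (n + 2), (shapeCount p.1 : ℝ) * shapeCount p.2 := by
      exact_mod_cast shapeCount_add_two n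
    linarith

/-- A function on tree-structures whose average over the structures of size `n` is bounded. -/
def MeanBdd (u : Shape → ℝ) : Prop :=
  ∃ D : ℝ, 0 ≤ D ∧ ∀ n, ∑ s ∈ shapes n, u s ≤ D * shapeCount n

/-- A function on pairs of tree-structures whose sum over the pairs of subtrees of the
structures of size `n` is bounded in average. -/
def PairBdd (F : Shape → Shape → ℝ) : Prop :=
  ∃ D : ℝ, 0 ≤ D ∧ ∀ n, ∑ p ∈ antidiagonal n, ∑ l ∈ shapes p.1, ∑ r ∈ shapes p.2, F l r ≤
    D * shapeCount n

theorem MeanBdd.add {u w : Shape → ℝ} (hu : MeanBdd u) (hw : MeanBdd w) :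
    MeanBdd fun s => u s + w s := by
  obtain ⟨D, hD, h⟩ := hu
  obtain ⟨E, hE, h'⟩ := hw
  refine ⟨D + E, add_nonneg hD hE, fun n => ?_⟩
  rw [Finset.sum_add_distrib, add_mul]
  exact add_le_add (h n) (h' n)

theorem MeanBdd.const_mul {u : Shape → ℝ} (hu : MeanBdd u) {a : ℝ} (ha : 0 ≤ a) :
    MeanBdd fun s => a * u s := by
  obtain ⟨D, hD, h⟩ := hu
  refine ⟨a * D, mul_nonneg ha hD, fun n => ?_⟩
  rw [← Finset.mul_sum, mul_assoc]
  exact mul_le_mul_of_nonneg_left (h n) ha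

theorem MeanBdd.mono {u w : Shape → ℝ} (hu : MeanBdd u) (h : ∀ s, w s ≤ u s) : MeanBdd w := by
  obtain ⟨D, hD, h'⟩ := hu
  exact ⟨D, hD, fun n => (Finset.sum_le_sum fun s _ => h s).trans (h' n)⟩

theorem meanBdd_one : MeanBdd fun _ => 1 :=
  ⟨1, zero_le_one, fun n => by simp [shapeCount]⟩

theorem PairBdd.add {F G : Shape → Shape → ℝ} (hF : PairBdd F) (hG : PairBdd G) :
    PairBdd fun l r => F l r + G l r := by
  obtain ⟨D, hD, h⟩ := hF
  obtain ⟨E, hE, h'⟩ := hG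
  refine ⟨D + E, add_nonneg hD hE, fun n => ?_⟩
  simp only [Finset.sum_add_distrib, add_mul]
  exact add_le_add (h n) (h' n)

theorem PairBdd.sum {ι : Type} (S : Finset ι) {F : ι → Shape → Shape → ℝ}
    (h : ∀ i ∈ S, PairBdd (F i)) : PairBdd fun l r => ∑ i ∈ S, F i l r := by
  classical
  induction S using Finset.induction_on with
  | empty => exact ⟨0, le_rfl, fun n => by simp⟩
  | insert i S hi ih =>
    simp only [Finset.sum_insert hi]
    exact (h i (Finset.mem_insert_self _ _)).add
      (ih fun j hj => h j (Finset.mem_insert_of_mem hj))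

theorem MeanBdd.pair {u w : Shape → ℝ} (hu : MeanBdd u) (hw : MeanBdd w) (hu0 : ∀ s, 0 ≤ u s) :
    PairBdd fun l r => u l * w r := by
  obtain ⟨D, hD, h⟩ := hu
  obtain ⟨E, hE, h'⟩ := hw
  refine ⟨D * E, mul_nonneg hD hE, fun n => ?_⟩
  calc _ ≤ ∑ p ∈ antidiagonal n, D * E * ((shapeCount p.1 : ℝ) * shapeCount p.2) := by
        refine Finset.sum_le_sum fun p _ => ?_
        rw [← Finset.sum_mul_sum]
        calc _ ≤ (∑ l ∈ shapes p.1, u l) * (E * shapeCount p.2) :=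
              mul_le_mul_of_nonneg_left (h' _) (Finset.sum_nonneg fun s _ => hu0 s)
          _ ≤ (D * shapeCount p.1) * (E * shapeCount p.2) :=
              mul_le_mul_of_nonneg_right (h _) (by positivity)
          _ = _ := by ring
    _ ≤ D * E * (shapeCount n / 2) := by
        rw [← Finset.mul_sum]
        exact mul_le_mul_of_nonneg_left (sum_shapeCount_mul_le n) (mul_nonneg hD hE)
    _ ≤ _ := mul_le_mul_of_nonneg_left (by linarith [(shapeCount n).cast_nonneg (α := ℝ)])
        (mul_nonneg hD hE)

/-- A linear recursive inequality dominated by the growth of the number of tree-structures. -/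
theorem exists_le_mul_shapeCount {m : ℕ → ℝ} (hm : ∀ n, 0 ≤ m n) (hm0 : m 0 = 0) {β : ℝ}
    (hβ : 0 ≤ β) (h : ∀ n, m (n + 2) ≤ β * shapeCount (n + 2) +
      303 / 100 * ∑ p ∈ antidiagonal (n + 2), m p.1 * shapeCount p.2) :
    ∃ D : ℝ, 0 ≤ D ∧ ∀ n, m n ≤ D * shapeCount n := by
  have hc0 : ∀ n, (0 : ℝ) ≤ shapeCount n := fun n => Nat.cast_nonneg _
  have hc1 : ∀ n, (1 : ℝ) ≤ shapeCount (n + 1) := fun n => by exact_mod_cast shapeCount_pos n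
  have hmono : ∀ n, (shapeCount n : ℝ) ≤ shapeCount (n + 1) := fun n => by
    exact_mod_cast shapeCount_le_succ n
  have h8 : ∀ n, (shapeCount (n + 2) : ℝ) ≤ 8 * shapeCount (n + 1) := fun n => by
    exact_mod_cast shapeCount_succ_le n
  set M : ℝ := m 1 + m 2 + m 3 with hM
  have hM0 : 0 ≤ M := by linarith [hm 1, hm 2, hm 3]
  refine ⟨200 * (β + 303 / 100 * M) + M, by positivity, fun n => ?_⟩
  set D : ℝ := 200 * (β + 303 / 100 * M) + M with hD
  have hD0 : 0 ≤ D := by positivity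
  have hDM : M ≤ D := by rw [hD]; nlinarith
  have hs3 : shapeCount 3 = 8 := by
    rw [shapeCount_succ, catalan_two]
    norm_num
  have hs2 : shapeCount 2 = 2 := by
    rw [shapeCount_succ, catalan_one]
    norm_num
  induction n using Nat.strong_induction_on with
  | _ n ih =>
    rcases n with _ | _ | _ | _ | n
    · rw [hm0]
      exact mul_nonneg hD0 (hc0 _)
    · have := hc1 0
      nlinarith [hm 1, hm 2, hm 3]
    · have := hc1 1
      nlinarith [hm 1, hm 2, hm 3]
    · have := hc1 2
      nlinarith [hm 1, hm 2, hm 3]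
    · have hsum : ∀ F : ℕ → ℝ, ∑ p ∈ antidiagonal (n + 4), F p.1 * shapeCount p.2 =
          F 0 * shapeCount (n + 4) + F 1 * shapeCount (n + 3) + F 2 * shapeCount (n + 2) +
          F 3 * shapeCount (n + 1) + ∑ p ∈ antidiagonal n, F (p.1 + 4) * shapeCount p.2 := by
        intro F
        rw [Finset.Nat.sum_antidiagonal_succ, Finset.Nat.sum_antidiagonal_succ,
          Finset.Nat.sum_antidiagonal_succ, Finset.Nat.sum_antidiagonal_succ]
        ring
      have hup := h (n + 2)
      rw [hsum] at hup
      have hcat := sum_shapeCount_mul_le (n + 4)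
      rw [hsum fun i => (shapeCount i : ℝ)] at hcat
      have htail : ∑ p ∈ antidiagonal n, m (p.1 + 4) * shapeCount p.2 ≤
          D * ∑ p ∈ antidiagonal n, (shapeCount (p.1 + 4) : ℝ) * shapeCount p.2 := by
        rw [Finset.mul_sum]
        refine Finset.sum_le_sum fun p hp => ?_
        have hp' := mem_antidiagonal.1 hp
        rcases Nat.eq_zero_or_pos p.2 with h2 | h2
        · simp [h2, shapeCount_zero]
        · rw [← mul_assoc]
          exact mul_le_mul_of_nonneg_right (ih _ (by omega)) (hc0 _)
      simp only [shapeCount_zero, shapeCount_one, hs2, hs3, Nat.cast_zero, Nat.cast_one,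
        Nat.cast_ofNat, hm0, zero_mul, zero_add, one_mul] at hcat hup
      have e1 := hmono (n + 1)
      have e2 := hmono (n + 2)
      have e3 := hmono (n + 3)
      have g1 := h8 n
      have g2 := h8 (n + 1)
      have g3 := h8 (n + 2)
      simp only [add_assoc, Nat.reduceAdd] at *
      have k1 : m 1 * shapeCount (n + 3) ≤ m 1 * shapeCount (n + 4) :=
        mul_le_mul_of_nonneg_left e3 (hm 1)
      have k2 : m 2 * shapeCount (n + 2) ≤ m 2 * shapeCount (n + 4) :=
        mul_le_mul_of_nonneg_left (by linarith) (hm 2)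
      have k3 : m 3 * shapeCount (n + 1) ≤ m 3 * shapeCount (n + 4) :=
        mul_le_mul_of_nonneg_left (by linarith) (hm 3)
      have k4 : ∑ p ∈ antidiagonal n, (shapeCount (p.1 + 4) : ℝ) * shapeCount p.2 ≤
          21 / 64 * shapeCount (n + 4) := by linarith
      have k5 := mul_le_mul_of_nonneg_left k4 hD0
      have k6 : m (n + 4) ≤
          (β + 303 / 100 * (m 1 + m 2 + m 3) + 303 / 100 * (21 / 64) * D) * shapeCount (n + 4) := by
        linarith
      refine k6.trans (mul_le_mul_of_nonneg_right ?_ (hc0 _))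
      have : 200 * (β + 303 / 100 * M) ≤ D := by linarith
      linarith

theorem exists_add_pow_le (r : ℕ) : ∃ C : ℝ, 0 ≤ C ∧ ∀ a k : ℝ, 0 ≤ a → 0 ≤ k →
    (a + k) ^ r ≤ 101 / 100 * a ^ r + C * k ^ r := by
  have hcont : Tendsto (fun δ : ℝ => (1 + δ) ^ r) (nhds 0) (nhds 1) := by
    have : Continuous fun δ : ℝ => (1 + δ) ^ r := by fun_prop
    simpa using this.tendsto 0
  have hev : ∀ᶠ δ : ℝ in nhdsWithin 0 (Set.Ioi 0), (1 + δ) ^ r < 101 / 100 :=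
    (hcont.mono_left nhdsWithin_le_nhds).eventually_lt_const (by norm_num)
  obtain ⟨δ, hδ, hδ0⟩ := (hev.and self_mem_nhdsWithin).exists
  have hδ0 : 0 < δ := hδ0
  refine ⟨(1 / δ + 1) ^ r, by positivity, fun a k ha hk => ?_⟩
  rcases le_total k (δ * a) with h | h
  · calc (a + k) ^ r ≤ ((1 + δ) * a) ^ r := pow_le_pow_left₀ (by positivity) (by linarith) r
      _ = (1 + δ) ^ r * a ^ r := mul_pow _ _ _
      _ ≤ 101 / 100 * a ^ r := mul_le_mul_of_nonneg_right hδ.le (by positivity)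
      _ ≤ _ := le_add_of_nonneg_right (by positivity)
  · calc (a + k) ^ r ≤ ((1 / δ + 1) * k) ^ r := by
          refine pow_le_pow_left₀ (by positivity) ?_ r
          have : a ≤ 1 / δ * k := by
            rw [div_mul_eq_mul_div, one_mul, le_div_iff₀ hδ0]
            linarith
          linarith
      _ = (1 / δ + 1) ^ r * k ^ r := mul_pow _ _ _
      _ ≤ _ := le_add_of_nonneg_left (by positivity)

/-- All the moments of a statistic on tree-structures are bounded. -/
def MomentsBdd (h : Shape → ℕ) : Prop := ∀ r : ℕ, MeanBdd fun s => (h s : ℝ) ^ r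

theorem MomentsBdd.add {g h : Shape → ℕ} (hg : MomentsBdd g) (hh : MomentsBdd h) :
    MomentsBdd fun s => g s + h s := by
  intro r
  obtain ⟨C, hC, hle⟩ := exists_add_pow_le r
  refine (((hg r).const_mul (a := 101 / 100) (by norm_num)).add ((hh r).const_mul hC)).mono
    fun s => ?_
  rw [Nat.cast_add]
  exact hle _ _ (Nat.cast_nonneg _) (Nat.cast_nonneg _)

theorem MomentsBdd.mono {g h : Shape → ℕ} (hg : MomentsBdd g) (hle : ∀ s, h s ≤ g s) :
    MomentsBdd h := fun r => (hg r).mono fun s =>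
  pow_le_pow_left₀ (Nat.cast_nonneg _) (Nat.cast_le.2 (hle s)) r

theorem momentsBdd_one : MomentsBdd fun _ => 1 := fun r => by simpa using meanBdd_one

/-- A statistic bounded, at a node with the connective `c`, by the sum of its values at both
subtrees and, at a node with the other connective, by its value at the left subtree has
bounded moments; this remains true up to statistics with bounded moments. -/
theorem momentsBdd_of_node_le {c : Conn} {g h : Shape → ℕ} (hh : MomentsBdd h)
    (hc : ∀ l r, g (.node c l r) ≤ g l + h l + (g r + h r))
    (hd : ∀ l r, g (.node c.dual l r) ≤ g l + h l + h r) : MomentsBdd g := by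
  intro r
  induction r using Nat.strong_induction_on with
  | _ r ih =>
    rcases Nat.eq_zero_or_pos r with rfl | hr
    · simpa using meanBdd_one
    obtain ⟨C, hC, hle⟩ := exists_add_pow_le r
    have hx : ∀ i < r, MeanBdd fun s => ((g s : ℝ) + h s) ^ i := by
      intro i hi
      obtain ⟨C, hC, hle⟩ := exists_add_pow_le i
      exact (((ih i hi).const_mul (a := 101 / 100) (by norm_num)).add
        ((hh i).const_mul hC)).mono fun s => hle _ _ (Nat.cast_nonneg _) (Nat.cast_nonneg _)
    have hone : ∀ s : Shape, (0 : ℝ) ≤ 1 := fun _ => zero_le_one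
    have hrest := ((((hh r).const_mul (mul_nonneg zero_le_two hC)).pair meanBdd_one
        (fun s => by positivity)).add
      ((meanBdd_one.pair (((hh r).const_mul hC).add (hh r)) hone))).add
      (PairBdd.sum (Finset.Ico 1 r) fun i hi =>
        ((hx i (Finset.mem_Ico.1 hi).2).const_mul (a := (r.choose i : ℝ)) (Nat.cast_nonneg _)).pair
          ((hx (r - i) (by have := Finset.mem_Ico.1 hi; omega)).add (hh (r - i)))
          fun s => by positivity)
    obtain ⟨β, hβ, hrest⟩ := hrest
    have hbin : ∀ x y : ℝ, (x + y) ^ r = x ^ r + y ^ r +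
        ∑ i ∈ Finset.Ico 1 r, x ^ i * y ^ (r - i) * r.choose i := by
      intro x y
      rw [add_pow, Finset.sum_range_succ, Finset.range_eq_Ico, Finset.sum_eq_sum_Ico_succ_bot hr]
      simp
      ring
    have hpt : ∀ l s : Shape, ((g (.node c l s) : ℝ)) ^ r + (g (.node c.dual l s) : ℝ) ^ r ≤
        (2 * (101 / 100) * (g l : ℝ) ^ r + 101 / 100 * (g s : ℝ) ^ r) +
        ((2 * C * (h l : ℝ) ^ r * 1 + 1 * (C * (h s : ℝ) ^ r + (h s : ℝ) ^ r)) +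
        ∑ i ∈ Finset.Ico 1 r, (r.choose i : ℝ) * ((g l : ℝ) + h l) ^ i *
          (((g s : ℝ) + h s) ^ (r - i) + (h s : ℝ) ^ (r - i))) := by
      intro l s
      have h1 : (g (.node c l s) : ℝ) ^ r ≤ ((g l + h l) + (g s + h s)) ^ r :=
        pow_le_pow_left₀ (Nat.cast_nonneg _) (by exact_mod_cast hc l s) r
      have h2 : (g (.node c.dual l s) : ℝ) ^ r ≤ ((g l + h l) + h s) ^ r :=
        pow_le_pow_left₀ (Nat.cast_nonneg _) (by exact_mod_cast hd l s) r
      rw [hbin] at h1 h2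
      have h3 := hle (g l) (h l) (Nat.cast_nonneg _) (Nat.cast_nonneg _)
      have h4 := hle (g s) (h s) (Nat.cast_nonneg _) (Nat.cast_nonneg _)
      have h5 : ∑ i ∈ Finset.Ico 1 r, (r.choose i : ℝ) * ((g l : ℝ) + h l) ^ i *
          (((g s : ℝ) + h s) ^ (r - i) + (h s : ℝ) ^ (r - i)) =
          ∑ i ∈ Finset.Ico 1 r, ((g l : ℝ) + h l) ^ i * ((g s : ℝ) + h s) ^ (r - i) * r.choose i +
          ∑ i ∈ Finset.Ico 1 r, ((g l : ℝ) + h l) ^ i * (h s : ℝ) ^ (r - i) * r.choose i := by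
        rw [← Finset.sum_add_distrib]
        exact Finset.sum_congr rfl fun i _ => by ring
      rw [h5]
      linarith
    refine exists_le_mul_shapeCount (m := fun n => ∑ s ∈ shapes n, (g s : ℝ) ^ r)
      (fun n => Finset.sum_nonneg fun s _ => by positivity) (by simp [shapes_zero]) hβ fun n => ?_
    rw [sum_shapes_of_dual c]
    refine (Finset.sum_le_sum fun p _ => Finset.sum_le_sum fun l _ => Finset.sum_le_sum fun s _ =>
      hpt l s).trans ?_
    have hadd : ∀ F G : Shape → Shape → ℝ, ∑ p ∈ antidiagonal (n + 2), ∑ l ∈ shapes p.1,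
        ∑ s ∈ shapes p.2, (F l s + G l s) =
        ∑ p ∈ antidiagonal (n + 2), ∑ l ∈ shapes p.1, ∑ s ∈ shapes p.2, F l s +
        ∑ p ∈ antidiagonal (n + 2), ∑ l ∈ shapes p.1, ∑ s ∈ shapes p.2, G l s := fun F G => by
      simp only [Finset.sum_add_distrib]
    rw [hadd, hadd, add_comm]
    refine add_le_add (hrest (n + 2)) (le_of_eq ?_)
    have hl : ∑ p ∈ antidiagonal (n + 2), ∑ l ∈ shapes p.1, ∑ _s ∈ shapes p.2,
        2 * (101 / 100) * (g l : ℝ) ^ r = 2 * (101 / 100) *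
        ∑ p ∈ antidiagonal (n + 2), (∑ l ∈ shapes p.1, (g l : ℝ) ^ r) * shapeCount p.2 := by
      simp only [Finset.sum_const, nsmul_eq_mul, Finset.mul_sum, Finset.sum_mul]
      refine Finset.sum_congr rfl fun p _ => Finset.sum_congr rfl fun l _ => ?_
      rw [← shapeCount]
      ring
    have hr' : ∑ p ∈ antidiagonal (n + 2), ∑ _l ∈ shapes p.1, ∑ s ∈ shapes p.2,
        101 / 100 * (g s : ℝ) ^ r = 101 / 100 *
        ∑ p ∈ antidiagonal (n + 2), (∑ l ∈ shapes p.1, (g l : ℝ) ^ r) * shapeCount p.2 := by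
      rw [← Finset.Nat.sum_antidiagonal_swap, Finset.mul_sum]
      refine Finset.sum_congr rfl fun p _ => ?_
      simp only [Finset.sum_const, nsmul_eq_mul, ← Finset.mul_sum, Prod.fst_swap, Prod.snd_swap]
      rw [← shapeCount]
      ring
    rw [hl, hr']
    ring

theorem momentsBdd_card_pat (c : Conn) : MomentsBdd fun s => (pat c s).card := by
  refine momentsBdd_of_node_le (c := c) momentsBdd_one (fun l r => ?_) fun l r => ?_
  · simp only [pat, if_true, Pos.card_join]
    omega
  · simp only [pat, Conn.dual_ne, if_false, Pos.card_join, Finset.card_empty]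
    omega

theorem momentsBdd_card_altPat (c : Conn) : MomentsBdd fun s => (altPat c s).card := by
  refine momentsBdd_of_node_le (c := c) (momentsBdd_card_pat c) (fun l r => ?_) fun l r => ?_
  · simp only [altPat, if_true, Pos.card_join]
    omega
  · simp only [altPat, Conn.dual_ne, if_false, Pos.card_join]
    omega

theorem momentsBdd_card_childPat (c : Conn) : MomentsBdd fun s => (childPat c s).card := by
  refine momentsBdd_of_node_le (c := c) ((momentsBdd_card_pat c).add (momentsBdd_card_pat c.dual))
    (fun l r => ?_) fun l r => ?_
  all_goals
    simp only [childPat, Pos.card_join]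
    omega

theorem momentsBdd_card_scope : MomentsBdd fun s => (scope s).card := by
  have h : ∀ c, MomentsBdd fun s => (childScope c s).card := fun c =>
    ((momentsBdd_card_altPat c.dual).add (momentsBdd_card_childPat c)).mono fun s =>
      Finset.card_union_le _ _
  have hs : ∀ c l r, (scope (.node c l r)).card = (childScope c l).card + (childScope c r).card :=
    fun c l r => Pos.card_join _ _
  refine momentsBdd_of_node_le (c := .and) ((h .and).add (h .or)) (fun l r => ?_) fun l r => ?_
  · rw [hs]
    omega
  · rw [hs]
    simp only [Conn.dual]
    omega

theorem B_succ_right (n k : ℕ) : B n (k + 1) = B n k + stirling n (k + 1) / 2 ^ (k + 1) :=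
  Finset.sum_Icc_succ_top (by omega) _

theorem B_nonneg (n k : ℕ) : 0 ≤ B n k := Finset.sum_nonneg fun _ _ => by positivity

theorem B_mono (n : ℕ) : Monotone (B n) := monotone_nat_of_le_succ fun k => by
  rw [B_succ_right]
  exact le_add_of_nonneg_right (by positivity)

theorem B_succ_left {m : ℕ} (hm : m ≠ 0) (K : ℕ) :
    B (m + 1) (K + 1) = (∑ p ∈ Finset.Icc 1 (K + 1), (p : ℝ) * (stirling m p / 2 ^ p)) +
      B m K / 2 := by
  obtain ⟨m, rfl⟩ := Nat.exists_eq_succ_of_ne_zero hm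
  induction K with
  | zero => simp [B, stirling]
  | succ K ih =>
    rw [B_succ_right, ih, Finset.sum_Icc_succ_top (by omega : 1 ≤ K + 1 + 1), B_succ_right _ K,
      show stirling (m.succ + 1) (K + 1 + 1) =
        (K + 1 + 1) * stirling m.succ (K + 1 + 1) + stirling m.succ (K + 1) from rfl]
    push_cast
    ring

theorem B_succ_left_le {m : ℕ} (hm : m ≠ 0) (K : ℕ) :
    B (m + 1) K ≤ (K + 1 / 2) * B m K := by
  rcases K with _ | K
  · simp [B]
  · have h : ∑ p ∈ Finset.Icc 1 (K + 1), (p : ℝ) * (stirling m p / 2 ^ p) ≤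
        (K + 1 : ℕ) * B m (K + 1) := by
      rw [B, Finset.mul_sum]
      refine Finset.sum_le_sum fun p hp => mul_le_mul_of_nonneg_right ?_ (by positivity)
      exact_mod_cast (Finset.mem_Icc.1 hp).2
    rw [B_succ_left hm]
    have := B_mono m K.le_succ
    simp only [Nat.succ_eq_add_one] at this
    linarith

theorem stirling_self_pos (n : ℕ) : 1 ≤ stirling n n := by
  induction n with
  | zero => exact le_rfl
  | succ n ih => exact ih.trans (Nat.le_add_left _ _)

theorem B_pos {n k : ℕ} (hn : n ≠ 0) (hk : 1 ≤ k) : 0 < B n k := by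
  have h1 : 1 ≤ stirling n 1 := by
    obtain ⟨n, rfl⟩ := Nat.exists_eq_succ_of_ne_zero hn
    induction n with
    | zero => exact le_rfl
    | succ n ih =>
      refine (ih n.succ_ne_zero).trans ?_
      rw [show stirling n.succ.succ 1 = 1 * stirling n.succ 1 + stirling n.succ 0 from rfl]
      omega
  refine lt_of_lt_of_le ?_ (B_mono n hk)
  rw [B, Finset.Icc_self, Finset.sum_singleton]
  have : (0 : ℝ) < stirling n 1 := by exact_mod_cast h1
  positivity

theorem le_stirling (K j : ℕ) : (K + 1) ^ j ≤ stirling (K + 1 + j) (K + 1) := by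
  induction j with
  | zero => simpa using stirling_self_pos (K + 1)
  | succ j ih =>
    rw [show stirling (K + 1 + (j + 1)) (K + 1) =
      (K + 1) * stirling (K + 1 + j) (K + 1) + stirling (K + 1 + j) K from rfl, pow_succ']
    exact (Nat.mul_le_mul_left _ ih).trans (Nat.le_add_right _ _)

theorem eventually_B_le_stirling (K : ℕ) :
    ∀ᶠ m in atTop, B m K ≤ stirling m (K + 1) / 2 ^ (K + 1) := by
  have hB : ∀ j, B (K + 1 + j) K ≤ B (K + 1) K * ((K : ℝ) + 1 / 2) ^ j := by
    intro j
    induction j with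
    | zero => simp
    | succ j ih =>
      calc B (K + 1 + (j + 1)) K ≤ (K + 1 / 2) * B (K + 1 + j) K :=
            B_succ_left_le (m := K + 1 + j) (by omega) K
        _ ≤ (K + 1 / 2) * (B (K + 1) K * ((K : ℝ) + 1 / 2) ^ j) :=
            mul_le_mul_of_nonneg_left ih (by positivity)
        _ = _ := by ring
  have hK : (0 : ℝ) < K + 1 := by positivity
  have htend : Tendsto (fun j : ℕ => B (K + 1) K * 2 ^ (K + 1) *
      (((K : ℝ) + 1 / 2) / (K + 1)) ^ j) atTop (nhds 0) := by
    have := (tendsto_pow_atTop_nhds_zero_of_lt_one (r := ((K : ℝ) + 1 / 2) / (K + 1))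
      (by positivity) (by rw [div_lt_one hK]; linarith)).const_mul (B (K + 1) K * 2 ^ (K + 1))
    rwa [mul_zero] at this
  have hev := htend.eventually_le_const zero_lt_one
  obtain ⟨N, hN⟩ := eventually_atTop.1 hev
  refine eventually_atTop.2 ⟨K + 1 + N, fun m hm => ?_⟩
  obtain ⟨j, rfl⟩ : ∃ j, m = K + 1 + j := ⟨m - (K + 1), by omega⟩
  have h1 := hN j (by omega)
  have h2 : ((K : ℝ) + 1) ^ j ≤ stirling (K + 1 + j) (K + 1) := by
    exact_mod_cast le_stirling K j
  rw [div_pow, ← mul_div_assoc, div_le_one (by positivity)] at h1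
  rw [le_div_iff₀ (by positivity)]
  calc B (K + 1 + j) K * 2 ^ (K + 1)
      ≤ B (K + 1) K * ((K : ℝ) + 1 / 2) ^ j * 2 ^ (K + 1) :=
        mul_le_mul_of_nonneg_right (hB j) (by positivity)
    _ = B (K + 1) K * 2 ^ (K + 1) * ((K : ℝ) + 1 / 2) ^ j := by ring
    _ ≤ _ := h1.trans h2

theorem mul_B_sub_le (m a j : ℕ) : (a : ℝ) * (B m (a + j) - B m a) ≤
    ∑ p ∈ Finset.Icc 1 (a + j), (p : ℝ) * (stirling m p / 2 ^ p) := by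
  induction j with
  | zero => simpa using Finset.sum_nonneg fun p _ => by positivity
  | succ j ih =>
    rw [← add_assoc, Finset.sum_Icc_succ_top (by omega), B_succ_right]
    have : (a : ℝ) * (stirling m (a + j + 1) / 2 ^ (a + j + 1)) ≤
        (a + j + 1 : ℕ) * (stirling m (a + j + 1) / 2 ^ (a + j + 1)) :=
      mul_le_mul_of_nonneg_right (by exact_mod_cast (by omega)) (by positivity)
    linarith

theorem eventually_mul_B_le (M : ℕ) :
    ∃ N, ∀ m k, N ≤ m → N ≤ k → (M : ℝ) * B m k ≤ B (m + 1) k := by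
  obtain ⟨N, hN⟩ := eventually_atTop.1 (eventually_B_le_stirling (2 * M))
  refine ⟨N + (2 * M + 1) + 1, fun m k hm hk => ?_⟩
  have h1 := hN m (by omega)
  have h2 : 2 * B m (2 * M) ≤ B m k := by
    have := B_mono m (show 2 * M + 1 ≤ k by omega)
    rw [B_succ_right] at this
    linarith
  obtain ⟨k, rfl⟩ : ∃ j, k = j + 1 := ⟨k - 1, by omega⟩
  have h3 : (2 * M : ℕ) * (B m (k + 1) - B m (2 * M)) ≤
      ∑ p ∈ Finset.Icc 1 (k + 1), (p : ℝ) * (stirling m p / 2 ^ p) := by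
    have := mul_B_sub_le m (2 * M) (k + 1 - 2 * M)
    rwa [Nat.add_sub_cancel' (by omega)] at this
  rw [B_succ_left (by omega)]
  have := B_nonneg m k
  push_cast at h3
  nlinarith

/-- Twice the leading coefficient of the number of simple-x labellings of a node of type `c`,
counting those whose single leaf is the first subtree. -/
def sideWeight (c : Conn) : Shape → Shape → ℕ
  | .leaf, A => (pathSet c.dual A).card * ((pathSet c.dual A).card + 1)
  | .node _ _ _, _ => 0

/-- Twice the leading coefficient of the number of simple-x labellings of a tree-structure. -/
def simpleXWeight : Shape → ℕ
  | .leaf => 0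
  | .node c l r => sideWeight c l r + sideWeight c r l

theorem ne_leaf_of_size_ne_one {s : Shape} (hs : s.size ≠ 1) : s ≠ .leaf := by
  rintro rfl
  exact hs rfl

theorem sideWeight_eq_zero (c : Conn) {l : Shape} (hl : l.size ≠ 1) (r : Shape) :
    sideWeight c l r = 0 := by
  cases l with
  | leaf => exact absurd rfl hl
  | node => rfl

theorem sum_sideWeight (c : Conn) (j : ℕ) :
    2 * ∑ p ∈ antidiagonal (j + 3), ∑ l ∈ shapes p.1, ∑ r ∈ shapes p.2, sideWeight c l r =
      shapeCount (j + 3) + 2 * shapeCount (j + 2) := by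
  rw [Finset.sum_eq_single (1, j + 2)]
  · rw [shapes_one, Finset.sum_singleton]
    simp only [sideWeight, mul_add, mul_one, Finset.sum_add_distrib, sum_card_pathSet, ← sq]
    rw [sum_card_pathSet_sq]
  · rintro ⟨p, q⟩ hp hne
    refine Finset.sum_eq_zero fun l hl => Finset.sum_eq_zero fun r _ => ?_
    refine sideWeight_eq_zero c (fun h => hne ?_) r
    have hl' : l.size = p := mem_shapes.1 hl
    have hp' : p + q = j + 3 := mem_antidiagonal.1 hp
    rw [Prod.mk.injEq]
    omega
  · exact fun h => absurd (mem_antidiagonal.2 (by ring)) h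

theorem sum_simpleXWeight (j : ℕ) : ∑ s ∈ shapes (j + 3), simpleXWeight s =
    2 * shapeCount (j + 3) + 4 * shapeCount (j + 2) := by
  have hswap : ∀ c, ∑ p ∈ antidiagonal (j + 3), ∑ l ∈ shapes p.1, ∑ r ∈ shapes p.2,
      sideWeight c r l =
      ∑ p ∈ antidiagonal (j + 3), ∑ l ∈ shapes p.1, ∑ r ∈ shapes p.2, sideWeight c l r := by
    intro c
    rw [← Finset.Nat.sum_antidiagonal_swap]
    exact Finset.sum_congr rfl fun p _ => Finset.sum_comm
  rw [sum_shapes]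
  simp only [simpleXWeight, Finset.sum_add_distrib, hswap]
  have h1 := sum_sideWeight .and j
  have h2 := sum_sideWeight .or j
  linarith

/-- The number of classes of labellings of `s` with at most `K` variables satisfying `Q`. -/
noncomputable def labelCount (K : ℕ) (Q : AOTree → Prop) (s : Shape) : ℕ :=
  (ker '' {f : Pos s → ℕ × Bool | vars f ≤ K ∧ Q (ofShape s f)}).ncard

theorem classCount_eq_sum_labelCount (n K : ℕ) (Q : AOTree → Prop) :
    classCount (fun t => t.size = n ∧ t.varCount ≤ K ∧ Q t) =
      ∑ s ∈ shapes n, labelCount K Q s := by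
  rw [classCount_eq n fun t => t.varCount ≤ K ∧ Q t]
  simp only [varCount_ofShape]
  rfl

theorem Tcount_eq {n : ℕ} (hn : n ≠ 0) (K : ℕ) :
    (Tcount n K : ℝ) = shapeCount n * labCount n K := by
  rw [Tcount, classCount_eq n fun t => t.varCount ≤ K]
  simp only [varCount_ofShape]
  rw [Nat.cast_sum, Finset.sum_congr rfl fun s hs =>
    ncard_ker_le hn ((Pos.card_eq s).trans (mem_shapes.1 hs)) K, Finset.sum_const, nsmul_eq_mul,
    shapeCount]

theorem pathSet_dual_subset_childScope (c : Conn) (s : Shape) :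
    pathSet c.dual s ⊆ childScope c s :=
  (pathSet_subset_altPat _ _).trans Finset.subset_union_left

theorem labelCount_isSimpleX {j : ℕ} (K : ℕ) {s : Shape} (hs : s.size = j + 3) :
    2 * (labelCount K IsSimpleX s : ℝ) ≤ simpleXWeight s * labCount (j + 2) K ∧
      simpleXWeight s * labCount (j + 2) K ≤ 2 * (labelCount K IsSimpleX s : ℝ) +
        4 * ((scope s).card : ℝ) ^ 6 * labCount (j + 1) K := by
  have hcard := (Pos.card_eq s).trans hs
  rcases s with _ | ⟨c, A, B⟩
  · simp [Shape.size] at hs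
  by_cases hA : A = .leaf
  · subst hA
    have hB : B.size ≠ 1 := by
      intro h
      simp only [Shape.size] at hs
      omega
    have := ncard_ker_expands (n := j + 1) (K := K) (by omega) hcard
      (o := Pos.inl .here) (Λ := Pos.join ∅ (pathSet c.dual B)) (S := scope (.node c .leaf B))
      (by simp) (Finset.insert_subset (Pos.inl_mem_join.2 (by simp [altPat]))
        (Pos.join_subset (Finset.empty_subset _) (pathSet_dual_subset_childScope c B)))
    have hw : simpleXWeight (.node c .leaf B) =
        (pathSet c.dual B).card * ((pathSet c.dual B).card + 1) := by
      rw [simpleXWeight, sideWeight_eq_zero c hB, add_zero, sideWeight]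
    simpa [labelCount, isSimpleX_left (ne_leaf_of_size_ne_one hB), hw, Pos.card_join] using this
  by_cases hB : B = .leaf
  · subst hB
    have hA' : A.size ≠ 1 := by
      intro h
      simp only [Shape.size] at hs
      omega
    have := ncard_ker_expands (n := j + 1) (K := K) (by omega) hcard
      (o := Pos.inr .here) (Λ := Pos.join (pathSet c.dual A) ∅) (S := scope (.node c A .leaf))
      (by simp) (Finset.insert_subset (Pos.inr_mem_join.2 (by simp [altPat]))
        (Pos.join_subset (pathSet_dual_subset_childScope c A) (Finset.empty_subset _)))
    have hw : simpleXWeight (.node c A .leaf) =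
        (pathSet c.dual A).card * ((pathSet c.dual A).card + 1) := by
      rw [simpleXWeight, sideWeight_eq_zero c hA', zero_add, sideWeight]
    simpa [labelCount, isSimpleX_right hA, hw, Pos.card_join] using this
  · have h0 : simpleXWeight (.node c A B) = 0 := by
      rcases A with _ | _
      · exact absurd rfl hA
      rcases B with _ | _
      · exact absurd rfl hB
      rfl
    have h1 : labelCount K IsSimpleX (.node c A B) = 0 := by
      simp [labelCount, not_isSimpleX hA hB]
    have := labCount_nonneg (j + 1) K
    rw [h0, h1]
    simp
    positivity

theorem labelCount_le_labelCount_computesLit (K : ℕ) (s : Shape) :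
    labelCount K IsSimpleX s ≤ labelCount K ComputesLit s :=
  Set.ncard_le_ncard (Set.image_mono fun _ hf => ⟨hf.1, hf.2.computesLit⟩)

theorem labelCount_computesLit_le {j : ℕ} (K : ℕ) {s : Shape} (hs : s.size = j + 3) :
    (labelCount K ComputesLit s : ℝ) ≤ labelCount K IsSimpleX s +
      4 * ((scope s).card : ℝ) ^ 4 * labCount (j + 1) K := by
  have hsub : ker '' {f : Pos s → ℕ × Bool | vars f ≤ K ∧ ComputesLit (ofShape s f)} ⊆
      ker '' {f : Pos s → ℕ × Bool | vars f ≤ K ∧ IsSimpleX (ofShape s f)} ∪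
        ker '' {f : Pos s → ℕ × Bool | vars f ≤ K ∧ ¬ OneColl (scope s) f} := by
    rw [← Set.image_union]
    refine Set.image_mono fun f hf => ?_
    by_cases h : OneColl (scope s) f
    · rcases s with _ | ⟨c, A, B⟩
      · simp [Shape.size] at hs
      · exact Or.inl ⟨hf.1, isSimpleX_of_computesLit h hf.2⟩
    · exact Or.inr ⟨hf.1, h⟩
  have h1 := (Set.ncard_le_ncard hsub).trans (Set.ncard_union_le _ _)
  have h2 := ncard_ker_not_oneColl (n := j + 1) (K := K) (by omega)
    ((Pos.card_eq s).trans hs) (scope s)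
  have h3 : (labelCount K ComputesLit s : ℝ) ≤ labelCount K IsSimpleX s +
      (ker '' {f : Pos s → ℕ × Bool | vars f ≤ K ∧ ¬ OneColl (scope s) f}).ncard := by
    exact_mod_cast h1
  linarith

/-- Number of classes of simple-x trees. -/
noncomputable def simpleXCount (n K : ℕ) : ℕ :=
  classCount fun t => t.size = n ∧ t.varCount ≤ K ∧ IsSimpleX t

theorem TcountClass_proj_eq (n K : ℕ) : TcountClass n K (fun x => x 1) =
    classCount fun t => t.size = n ∧ t.varCount ≤ K ∧ ComputesLit t := by
  simp only [TcountClass, funEquiv_proj_iff]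

theorem exists_abs_sub_le : ∃ D : ℝ, ∀ j K,
    |(simpleXCount (j + 3) K : ℝ) -
      (shapeCount (j + 3) + 2 * shapeCount (j + 2)) * labCount (j + 2) K| ≤
        D * shapeCount (j + 3) * labCount (j + 1) K ∧
    |(TcountClass (j + 3) K (fun x => x 1) : ℝ) -
      (shapeCount (j + 3) + 2 * shapeCount (j + 2)) * labCount (j + 2) K| ≤
        D * shapeCount (j + 3) * labCount (j + 1) K := by
  obtain ⟨D, hD, h6⟩ := momentsBdd_card_scope 6
  obtain ⟨E, hE, h4⟩ := momentsBdd_card_scope 4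
  refine ⟨2 * D + 4 * E, fun j K => ?_⟩
  have hw := labCount_nonneg (j + 1) K
  have hX : (simpleXCount (j + 3) K : ℝ) =
      ∑ s ∈ shapes (j + 3), (labelCount K IsSimpleX s : ℝ) := by
    rw [simpleXCount, classCount_eq_sum_labelCount, Nat.cast_sum]
  have hL : (TcountClass (j + 3) K (fun x => x 1) : ℝ) =
      ∑ s ∈ shapes (j + 3), (labelCount K ComputesLit s : ℝ) := by
    rw [TcountClass_proj_eq, classCount_eq_sum_labelCount, Nat.cast_sum]
  have hW : (∑ s ∈ shapes (j + 3), (simpleXWeight s : ℝ)) =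
      2 * shapeCount (j + 3) + 4 * shapeCount (j + 2) := by
    exact_mod_cast sum_simpleXWeight j
  have hXle : 2 * (simpleXCount (j + 3) K : ℝ) ≤
      (2 * shapeCount (j + 3) + 4 * shapeCount (j + 2)) * labCount (j + 2) K := by
    rw [hX, ← hW, Finset.mul_sum, Finset.sum_mul]
    exact Finset.sum_le_sum fun s hs => (labelCount_isSimpleX K (mem_shapes.1 hs)).1
  have hleX : (2 * shapeCount (j + 3) + 4 * shapeCount (j + 2)) * labCount (j + 2) K ≤
      2 * (simpleXCount (j + 3) K : ℝ) + 4 * (D * shapeCount (j + 3)) * labCount (j + 1) K := by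
    refine le_trans ?_ (add_le_add_right (mul_le_mul_of_nonneg_right
      (mul_le_mul_of_nonneg_left (h6 (j + 3)) zero_le_four) hw) _)
    rw [hX, ← hW, Finset.mul_sum, Finset.mul_sum, Finset.sum_mul, Finset.sum_mul,
      ← Finset.sum_add_distrib]
    exact Finset.sum_le_sum fun s hs => (labelCount_isSimpleX K (mem_shapes.1 hs)).2
  have hXL : (simpleXCount (j + 3) K : ℝ) ≤ TcountClass (j + 3) K (fun x => x 1) := by
    rw [hX, hL]
    exact Finset.sum_le_sum fun s _ => by exact_mod_cast labelCount_le_labelCount_computesLit K s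
  have hLX : (TcountClass (j + 3) K (fun x => x 1) : ℝ) ≤ simpleXCount (j + 3) K +
      4 * (E * shapeCount (j + 3)) * labCount (j + 1) K := by
    refine le_trans ?_ (add_le_add_right (mul_le_mul_of_nonneg_right
      (mul_le_mul_of_nonneg_left (h4 (j + 3)) zero_le_four) hw) _)
    rw [hX, hL, Finset.mul_sum, Finset.sum_mul, ← Finset.sum_add_distrib]
    exact Finset.sum_le_sum fun s hs => labelCount_computesLit_le K (mem_shapes.1 hs)
  have hDn : 0 ≤ D * shapeCount (j + 3) * labCount (j + 1) K := by positivity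
  have hEn : 0 ≤ E * shapeCount (j + 3) * labCount (j + 1) K := by positivity
  refine ⟨abs_le.2 ⟨?_, ?_⟩, abs_le.2 ⟨?_, ?_⟩⟩ <;> linarith

theorem labCount_pos {n K : ℕ} (hn : n ≠ 0) (hK : 1 ≤ K) : 0 < labCount n K :=
  mul_pos (by positivity) (B_pos hn hK)

theorem tendsto_labCount_div {k : ℕ → ℕ} (hk : Tendsto k atTop atTop) :
    Tendsto (fun j => labCount (j + 1) (k (j + 3)) / labCount (j + 2) (k (j + 3))) atTop
      (nhds 0) := by
  refine tendsto_order.2 ⟨fun a ha => Eventually.of_forall fun j =>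
    ha.trans_le (div_nonneg (labCount_nonneg _ _) (labCount_nonneg _ _)), fun a ha => ?_⟩
  obtain ⟨M, hM⟩ := exists_nat_gt (1 / a)
  obtain ⟨N, hN⟩ := eventually_mul_B_le M
  filter_upwards [eventually_ge_atTop N,
    (hk.comp (tendsto_add_atTop_nat 3)).eventually_ge_atTop (N + 1)] with j hj hkj
  have hk1 : N + 1 ≤ k (j + 3) := hkj
  have h1 := hN (j + 1) (k (j + 3)) (by omega) (by omega)
  have hpos := B_pos (n := j + 1) (k := k (j + 3)) (by omega) (by omega)
  rw [div_lt_iff₀ (labCount_pos (by omega) (by omega)), labCount, labCount]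
  rw [div_lt_iff₀ ha] at hM
  have h2 : B (j + 1) (k (j + 3)) < a * B (j + 2) (k (j + 3)) := by
    calc B (j + 1) (k (j + 3)) = 1 * B (j + 1) (k (j + 3)) := (one_mul _).symm
      _ < M * a * B (j + 1) (k (j + 3)) := mul_lt_mul_of_pos_right hM hpos
      _ = a * (M * B (j + 1) (k (j + 3))) := by ring
      _ ≤ _ := mul_le_mul_of_nonneg_left h1 ha.le
  have h3 : (0 : ℝ) < 2 ^ (j + 1) := by positivity
  have h4 := mul_lt_mul_of_pos_left h2 h3
  have h5 : 0 ≤ 2 ^ (j + 1) * (a * B (j + 2) (k (j + 3))) :=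
    (mul_pos h3 hpos).le.trans h4.le
  rw [pow_succ _ (j + 1)]
  linarith

theorem tendsto_div_of_abs_sub_le {k : ℕ → ℕ} (hk : Tendsto k atTop atTop)
    (hk1 : ∀ n, 1 ≤ n → 1 ≤ k n) {F : ℕ → ℝ} {D : ℝ}
    (hF : ∀ j, |F j - (shapeCount (j + 3) + 2 * shapeCount (j + 2)) *
      labCount (j + 2) (k (j + 3))| ≤ D * shapeCount (j + 3) * labCount (j + 1) (k (j + 3))) :
    Tendsto (fun j => F j / (shapeCount (j + 3) * labCount (j + 2) (k (j + 3)))) atTop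
      (nhds (5 / 4)) := by
  have hmain : Tendsto (fun j : ℕ => 1 + 2 * ((shapeCount (j + 2) : ℝ) / shapeCount (j + 3)))
      atTop (nhds (5 / 4)) := by
    have := ((tendsto_shapeCount_div.comp (tendsto_add_atTop_nat 2)).const_mul 2).const_add 1
    norm_num at this
    exact this
  have herr : Tendsto (fun j => D * (labCount (j + 1) (k (j + 3)) / labCount (j + 2) (k (j + 3))))
      atTop (nhds 0) := by
    simpa using (tendsto_labCount_div hk).const_mul D
  refine tendsto_of_tendsto_of_dist hmain (squeeze_zero (fun _ => dist_nonneg) (fun j => ?_) herr)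
  have hc : (0 : ℝ) < shapeCount (j + 3) := by exact_mod_cast shapeCount_pos (j + 2)
  have hw : 0 < labCount (j + 2) (k (j + 3)) := labCount_pos (by omega) (hk1 _ (by omega))
  have heq : F j / (shapeCount (j + 3) * labCount (j + 2) (k (j + 3))) -
      (1 + 2 * ((shapeCount (j + 2) : ℝ) / shapeCount (j + 3))) =
      (F j - (shapeCount (j + 3) + 2 * shapeCount (j + 2)) * labCount (j + 2) (k (j + 3))) /
        (shapeCount (j + 3) * labCount (j + 2) (k (j + 3))) := by
    field_simp
  rw [dist_comm, Real.dist_eq, heq, abs_div, abs_of_pos (mul_pos hc hw),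
    div_le_iff₀ (mul_pos hc hw)]
  refine (hF j).trans_eq ?_
  field_simp

/-- for the class `⟨x⟩` of the projection `x ↦ x_1`,
`P_n⟨x⟩ ∼ (5/8)·rat_n`, and `P_n⟨x⟩` is asymptotically equal to the ratio of
classes of simple-x trees (of type T or X) among all classes of trees. -/
theorem stmt_16 (k : ℕ → ℕ) (hk_mono : Monotone k)
    (hk_pos : ∀ n, 1 ≤ n → 1 ≤ k n) (hk_le : ∀ n, 1 ≤ n → k n ≤ n)
    (hk_tend : Tendsto k atTop atTop) :
    Tendsto
      (fun n => Pclass n (k n) (fun x => x 1) / rat k n)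
      atTop (nhds (5 / 8)) ∧
    Tendsto
      (fun n => Pclass n (k n) (fun x => x 1) /
        (((classCount fun t =>
            t.size = n ∧ t.varCount ≤ k n ∧ (IsSimpleXT t ∨ IsSimpleXX t) : ℕ) : ℝ)
          / (Tcount n (k n) : ℝ)))
      atTop (nhds 1) := by
  obtain ⟨D, hD⟩ := exists_abs_sub_le
  have hX := tendsto_div_of_abs_sub_le hk_tend hk_pos fun j => (hD j (k (j + 3))).1
  have hL := tendsto_div_of_abs_sub_le hk_tend hk_pos fun j => (hD j (k (j + 3))).2
  have hc : ∀ j, (0 : ℝ) < shapeCount (j + 3) := fun j => by exact_mod_cast shapeCount_pos (j + 2)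
  have hw : ∀ j, 0 < labCount (j + 2) (k (j + 3)) := fun j =>
    labCount_pos (by omega) (hk_pos _ (by omega))
  have hB : ∀ j i, 0 < B (j + 1) (k (i + 1)) := fun j i => B_pos (by omega) (hk_pos _ (by omega))
  constructor
  · rw [← tendsto_add_atTop_iff_nat 3]
    have h := hL.const_mul (1 / 2)
    norm_num at h
    refine h.congr fun j => ?_
    have h2 := hB (j + 2) (j + 2)
    have h1 := hB (j + 1) (j + 2)
    have h0 := hc j
    rw [Pclass, rat, Tcount_eq (by omega), labCount, labCount,
      show j + 3 - 1 = j + 2 from rfl]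
    simp only [add_assoc, Nat.reduceAdd] at h1 h2
    field_simp
    ring
  · rw [← tendsto_add_atTop_iff_nat 3]
    have h := hL.div hX (by norm_num)
    norm_num at h
    refine h.congr fun j => ?_
    have hT : (Tcount (j + 3) (k (j + 3)) : ℝ) ≠ 0 := by
      rw [Tcount_eq (by omega)]
      exact (mul_pos (hc j) (labCount_pos (by omega) (hk_pos _ (by omega)))).ne'
    have hcw := (mul_pos (hc j) (hw j)).ne'
    simp only [Pi.div_apply]
    rw [div_div_div_cancel_right₀ hcw, Pclass, div_div_div_cancel_right₀ hT]
    rfl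

end CatalanSat
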